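/- arXiv:1102.0142 — 7 statements merged into one kernel-verified Lean document; each statement's English description precedes it below -/
import Mathlib

section
/- Let μ be the inhomogeneous Bernoulli product with weights (p_n) ⊂ (0,1) and suppose p_n → p ∈ (0,1) as n → ∞. Then for every q ∈ ℝ the sequence (τ_n(q)) converges to τ(p,q) = log₂(p^q + (1−p)^q), so that τ = τ(p,·), and μ satisfies the multifractal formalism: for every q ∈ ℝ, setting α = −∂τ(p,q)/∂q, one has dim( E_α ∩ F_α ) = τ*(α) = αq + τ(p,q). -/
open MeasureTheory Filter Set
open scoped Topology ENNReal NNReal Classical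

/-- The metric on `Σ = {0,1}^ℕ` in which two sequences are at distance `2^{-n}`,
`n` being the first index where they differ. -/
noncomputable instance : MetricSpace (ℕ → Bool) := PiNat.metricSpace

/-- The cylinder of generation `n` containing `x`. -/
def cyl (x : ℕ → Bool) (n : ℕ) : Set (ℕ → Bool) := {y | ∀ i < n, y i = x i}

/-- `τ(p,q) = log₂(p^q + (1-p)^q)`, the `L^q`-spectrum of the homogeneous Bernoulli
product of parameter `p`. -/
noncomputable def tauP (p q : ℝ) : ℝ := Real.logb 2 (p ^ q + (1 - p) ^ q)

/-- `τ_n(q) = (1/n) ∑_{k<n} log₂(p_k^q + (1-p_k)^q)`. -/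
noncomputable def tauN (p : ℕ → ℝ) (n : ℕ) (q : ℝ) : ℝ :=
  (1 / n) * ∑ k ∈ Finset.range n, tauP (p k) q

/-- The `L^q`-spectrum `τ(q) = limsup_n τ_n(q)`. -/
noncomputable def tauLq (p : ℕ → ℝ) (q : ℝ) : ℝ :=
  Filter.limsup (fun n => tauN p n q) Filter.atTop

/-- `μ` is the inhomogeneous Bernoulli product with weights `p`:
`μ(I_{ε_1…ε_n}) = ∏_{j=1}^n p_j^{1-ε_j} (1-p_j)^{ε_j}`. -/
def IsBernoulli (μ : Measure (ℕ → Bool)) (p : ℕ → ℝ) : Prop :=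
  ∀ (n : ℕ) (ε : ℕ → Bool),
    μ (cyl ε n) = ENNReal.ofReal (∏ j ∈ Finset.range n, if ε j then 1 - p j else p j)

/-- `α_n(x) = -log μ(I_n(x)) / (n log 2)`. -/
noncomputable def alphaN (μ : Measure (ℕ → Bool)) (x : ℕ → Bool) (n : ℕ) : ℝ :=
  -Real.log (μ (cyl x n)).toReal / (n * Real.log 2)

/-- The local dimension `α(x) = liminf_n α_n(x)`. -/
noncomputable def alphaDim (μ : Measure (ℕ → Bool)) (x : ℕ → Bool) : ℝ :=
  Filter.liminf (fun n => alphaN μ x n) Filter.atTop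

/-- The Legendre transform `τ*(α) = inf_{q ∈ ℝ} (α q + τ(q))`. -/
noncomputable def tauStar (p : ℕ → ℝ) (α : ℝ) : ℝ := ⨅ q : ℝ, (α * q + tauLq p q)

/-- `τ` is finite (i.e. the defining `limsup` is a genuine finite limsup) on a
neighborhood of `q`. -/
def TauFiniteNear (p : ℕ → ℝ) (q : ℝ) : Prop :=
  ∃ δ > (0:ℝ), ∀ q' ∈ Set.Ioo (q - δ) (q + δ),
    BddAbove (Set.range fun n => tauN p n q') ∧ BddBelow (Set.range fun n => tauN p n q')

/-- weights -/
noncomputable def bw (w : ℝ) (b : Bool) : ℝ := if b then 1 - w else w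

lemma bw_pos {w : ℝ} (hw : w ∈ Set.Ioo (0:ℝ) 1) (b : Bool) : 0 < bw w b := by
  unfold bw; split_ifs <;> linarith [hw.1, hw.2]

/-- minus log of the mass of a cylinder -/
noncomputable def gG (w : ℝ) (x : ℕ → Bool) (n : ℕ) : ℝ :=
  ∑ k ∈ Finset.range n, -Real.logb 2 (bw w (x k))

/-- Bernoulli measure on Bool -/
noncomputable def bm (w : ℝ) : Measure Bool :=
  ENNReal.ofReal w • Measure.dirac false + ENNReal.ofReal (1 - w) • Measure.dirac true

lemma bm_prob {w : ℝ} (hw : w ∈ Set.Ioo (0:ℝ) 1) : IsProbabilityMeasure (bm w) := by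
  constructor
  simp only [bm, Measure.coe_add, Measure.coe_smul, Pi.add_apply, Pi.smul_apply, measure_univ,
    smul_eq_mul, mul_one]
  rw [← ENNReal.ofReal_add hw.1.le (by linarith [hw.2])]
  simp

lemma bm_singleton (w : ℝ) (b : Bool) : bm w {b} = ENNReal.ofReal (bw w b) := by
  cases b <;> simp [bm, bw]

lemma prod_bw {w : ℝ} (hw : w ∈ Set.Ioo (0:ℝ) 1) (x : ℕ → Bool) (n : ℕ) :
    ∏ k ∈ Finset.range n, bw w (x k) = 2 ^ (-gG w x n) := by
  unfold gG
  induction n with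
  | zero => simp
  | succ n ih =>
    rw [Finset.prod_range_succ, Finset.sum_range_succ, ih, neg_add, Real.rpow_add two_pos, neg_neg,
      Real.rpow_logb two_pos (by norm_num) (bw_pos hw _)]

lemma cyl_eq_pi (x : ℕ → Bool) (n : ℕ) :
    cyl x n = Set.pi (Finset.range n : Set ℕ) (fun i => {x i}) := by
  ext y; simp [cyl, Set.mem_pi]

lemma measurableSet_cyl (x : ℕ → Bool) (n : ℕ) : MeasurableSet (cyl x n) := by
  rw [cyl_eq_pi]
  exact MeasurableSet.pi (Finset.countable_toSet _) (fun i _ => measurableSet_singleton _)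

lemma nu_cyl {w : ℝ} (hw : w ∈ Set.Ioo (0:ℝ) 1) (x : ℕ → Bool) (n : ℕ) :
    Measure.infinitePi (fun _ : ℕ => bm w) (cyl x n) = ENNReal.ofReal (2 ^ (-gG w x n)) := by
  have := bm_prob hw
  rw [cyl_eq_pi, Measure.infinitePi_pi _ (fun i _ => measurableSet_singleton _)]
  simp only [bm_singleton]
  rw [← ENNReal.ofReal_prod_of_nonneg (fun i _ => (bw_pos hw _).le), prod_bw hw]

lemma cpow (n : ℕ) (t : ℝ) :
    (ENNReal.ofReal ((1/2:ℝ)^n))^t = ENNReal.ofReal (2 ^ (-(n * t)) : ℝ) := by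
  rw [ENNReal.ofReal_rpow_of_pos (by positivity)]
  congr 1
  rw [← Real.rpow_natCast, ← Real.rpow_mul (by norm_num), one_div,
    Real.inv_rpow (by norm_num), ← Real.rpow_neg (by norm_num)]

lemma edist_of_ne {x y : ℕ → Bool} (h : x ≠ y) :
    edist x y = ENNReal.ofReal ((1/2:ℝ)^(PiNat.firstDiff x y)) := by
  rw [edist_dist]
  congr 1
  exact PiNat.dist_eq_of_ne h

lemma edist_le_of_mem {x y z : ℕ → Bool} {n : ℕ} (hy : y ∈ cyl x n) (hz : z ∈ cyl x n) :
    edist y z ≤ ENNReal.ofReal ((1/2:ℝ)^n) := by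
  by_cases h : y = z
  · subst h; simp
  rw [edist_of_ne h]
  apply ENNReal.ofReal_le_ofReal
  apply pow_le_pow_of_le_one (by norm_num) (by norm_num)
  by_contra hlt
  push Not at hlt
  exact PiNat.apply_firstDiff_ne h ((hy _ hlt).trans (hz _ hlt).symm)

lemma measurable_gG (w : ℝ) (n : ℕ) : Measurable (fun x => gG w x n) := by
  unfold gG
  apply Finset.measurable_sum
  intro k _
  exact (measurable_of_finite (fun b => -Real.logb 2 (bw w b))).comp (measurable_pi_apply k)

/-- extension of a finite word -/
def ext0 (n : ℕ) (e : Fin n → Bool) : ℕ → Bool := fun i => if h : i < n then e ⟨i, h⟩ else false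

lemma upper {w : ℝ} (hw : w ∈ Set.Ioo (0:ℝ) 1) {t : ℝ≥0} (ht : 0 < t) (N : ℕ) :
    dimH {x | ∀ n ≥ N, gG w x n ≤ n * t} ≤ t := by
  have := bm_prob hw
  set A := {x | ∀ n ≥ N, gG w x n ≤ n * t} with hA
  apply dimH_le_of_hausdorffMeasure_ne_top
  set T : ∀ n : ℕ, (Fin n → Bool) → Set (ℕ → Bool) := fun n e => cyl (ext0 n e) n ∩ A with hT
  have hd : ∀ n e, Metric.ediam (T n e) ≤ ENNReal.ofReal ((1/2:ℝ)^n) := by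
    intro n e
    apply Metric.ediam_le
    intro y hy z hz
    exact edist_le_of_mem hy.1 hz.1
  have hr : Tendsto (fun n : ℕ => ENNReal.ofReal ((1/2:ℝ)^n)) atTop (𝓝 0) := by
    rw [← ENNReal.ofReal_zero]
    exact (ENNReal.continuous_ofReal.tendsto 0).comp
      (tendsto_pow_atTop_nhds_zero_of_lt_one (by norm_num) (by norm_num))
  have key := Measure.hausdorffMeasure_le_liminf_sum (t:ℝ) A (l := atTop) _ hr T
    (Eventually.of_forall hd) (Eventually.of_forall (fun n x hx => by
      refine mem_iUnion.2 ⟨fun i => x i, ?_, hx⟩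
      intro i hi
      simp [ext0, hi]))
  have hb : ∀ᶠ n in atTop, (∑ i, Metric.ediam (T n i) ^ (t:ℝ)) ≤ 1 := by
    filter_upwards [eventually_ge_atTop N] with n hn
    calc (∑ i, Metric.ediam (T n i) ^ (t:ℝ))
        ≤ ∑ i, Measure.infinitePi (fun _ : ℕ => bm w) (cyl (ext0 n i) n) := by
          apply Finset.sum_le_sum
          intro e _
          rcases (T n e).eq_empty_or_nonempty with h | ⟨x, hx⟩
          · rw [h, Metric.ediam_empty, ENNReal.zero_rpow_of_pos (by exact_mod_cast ht)]
            exact zero_le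
          · refine (ENNReal.rpow_le_rpow (hd n e) t.2).trans ?_
            rw [cpow]
            have hcx : cyl (ext0 n e) n = cyl x n := by
              ext y
              constructor
              · intro hy i hi; rw [hy i hi, hx.1 i hi]
              · intro hy i hi; rw [hy i hi, hx.1 i hi]
            rw [hcx, nu_cyl hw]
            apply ENNReal.ofReal_le_ofReal
            apply Real.rpow_le_rpow_of_exponent_le (by norm_num)
            exact neg_le_neg (hx.2 n hn)
      _ = Measure.infinitePi (fun _ : ℕ => bm w) (⋃ i ∈ (Finset.univ : Finset (Fin n → Bool)), cyl (ext0 n i) n) := by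
          rw [measure_biUnion_finset]
          · intro a _ b _ hab
            rw [Function.onFun, Set.disjoint_left]
            intro y hya hyb
            apply hab
            ext i
            have h1 := hya i i.2
            have h2 := hyb i i.2
            rw [h1] at h2
            simpa [ext0] using h2
          · intro e _; exact measurableSet_cyl _ _
      _ ≤ 1 := prob_le_one
  have : Measure.hausdorffMeasure (t:ℝ) A ≤ 1 := by
    refine key.trans ?_
    exact (liminf_le_liminf hb).trans (by simp)
  exact (this.trans_lt ENNReal.one_lt_top).ne

lemma lower {w : ℝ} (hw : w ∈ Set.Ioo (0:ℝ) 1) {t : ℝ≥0} (ht : 0 < t) (N : ℕ)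
    (C : Set (ℕ → Bool)) (hC : C ⊆ {x | ∀ n ≥ N, n * t ≤ gG w x n})
    (hpos : Measure.infinitePi (fun _ : ℕ => bm w) C ≠ 0) :
    t ≤ dimH C := by
  have := bm_prob hw
  set B := {x | ∀ n ≥ N, n * t ≤ gG w x n} with hB
  set ν := Measure.infinitePi (fun _ : ℕ => bm w) with hν
  have hBm : MeasurableSet B := by
    have : B = ⋂ n ≥ N, {x | n * t ≤ gG w x n} := by ext; simp [hB]
    rw [this]
    exact MeasurableSet.iInter fun n => MeasurableSet.iInter fun _ =>
      measurableSet_le measurable_const (measurable_gG w n)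
  apply le_dimH_of_hausdorffMeasure_ne_zero
  have key : ν.restrict B ≤ Measure.hausdorffMeasure (t:ℝ) := by
    apply Measure.le_hausdorffMeasure _ _ (ENNReal.ofReal ((1/2:ℝ)^N)) (by positivity)
    intro S hS
    rw [Measure.restrict_apply' hBm]
    rcases (S ∩ B).eq_empty_or_nonempty with h | ⟨x, hxS, hxB⟩
    · rw [h]; simp
    have hcyl : ∀ n ≥ N, S ⊆ cyl x n → ν (S ∩ B) ≤ (ENNReal.ofReal ((1/2:ℝ)^n))^(t:ℝ) := by
      intro n hn hsub
      calc ν (S ∩ B) ≤ ν (cyl x n) := measure_mono (inter_subset_left.trans hsub)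
        _ ≤ _ := by
          rw [nu_cyl hw, cpow]
          apply ENNReal.ofReal_le_ofReal
          apply Real.rpow_le_rpow_of_exponent_le (by norm_num)
          linarith [hxB n hn]
    by_cases hex : ∃ n, ∃ y ∈ S, x ≠ y ∧ PiNat.firstDiff x y = n
    · set n := Nat.find hex with hn
      obtain ⟨y, hyS, hxy, hfd⟩ := Nat.find_spec hex
      have hed : ENNReal.ofReal ((1/2:ℝ)^n) ≤ Metric.ediam S := by
        rw [hn, ← hfd, ← edist_of_ne hxy]
        exact Metric.edist_le_ediam_of_mem hxS hyS
      have hnN : N ≤ n := by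
        have := hed.trans hS
        rw [ENNReal.ofReal_le_ofReal_iff (by positivity)] at this
        exact (pow_le_pow_iff_right_of_lt_one₀ (by norm_num) (by norm_num)).1 this
      refine (hcyl n hnN ?_).trans (ENNReal.rpow_le_rpow hed t.2)
      intro z hz i hi
      by_cases hxz : x = z
      · rw [hxz]
      · have : n ≤ PiNat.firstDiff x z := Nat.find_min' hex ⟨z, hz, hxz, rfl⟩
        exact (PiNat.apply_eq_of_lt_firstDiff (hi.trans_le this)).symm
    · have hS1 : ∀ y ∈ S, x = y := by
        intro y hy
        by_contra hne
        exact hex ⟨_, y, hy, hne, rfl⟩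
      have hlim : Tendsto (fun n : ℕ => (ENNReal.ofReal ((1/2:ℝ)^n))^(t:ℝ)) atTop (𝓝 0) := by
        have h0 : Tendsto (fun n : ℕ => ENNReal.ofReal ((1/2:ℝ)^n)) atTop (𝓝 0) := by
          rw [← ENNReal.ofReal_zero]
          exact (ENNReal.continuous_ofReal.tendsto 0).comp
            (tendsto_pow_atTop_nhds_zero_of_lt_one (by norm_num) (by norm_num))
        have := (ENNReal.continuous_rpow_const (y := (t:ℝ))).tendsto 0
        rw [ENNReal.zero_rpow_of_pos (by exact_mod_cast ht)] at this
        exact this.comp h0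
      have : ν (S ∩ B) ≤ 0 := by
        apply ge_of_tendsto hlim
        filter_upwards [eventually_ge_atTop N] with n hn
        apply hcyl n hn
        intro y hy i _
        rw [hS1 y hy]
      exact this.trans zero_le
  intro h0
  have := key C
  rw [Measure.restrict_apply' hBm, inter_eq_left.2 hC, h0] at this
  exact hpos (le_antisymm this zero_le)

lemma slln {w : ℝ} (hw : w ∈ Set.Ioo (0:ℝ) 1) (f : Bool → ℝ) :
    ∀ᵐ x ∂(Measure.infinitePi (fun _ : ℕ => bm w)),
      Tendsto (fun n : ℕ => (∑ k ∈ Finset.range n, f (x k)) / n) atTop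
        (𝓝 (w * f false + (1 - w) * f true)) := by
  have := bm_prob hw
  have hf : Measurable f := measurable_of_finite f
  have hfi : Integrable f (bm w) := Integrable.of_finite
  have h := ProbabilityTheory.strong_law_ae_real (μ := Measure.infinitePi (fun _ : ℕ => bm w))
    (fun k x => f (x k))
    ((measurePreserving_eval_infinitePi (fun _ : ℕ => bm w) 0).integrable_comp_of_integrable hfi)
    (fun i j hij => (ProbabilityTheory.iIndepFun_infinitePi (P := fun _ : ℕ => bm w)
      (X := fun _ => f) (fun _ => hf)).indepFun hij)
    (fun i => by
      refine ⟨(hf.comp (measurable_pi_apply i)).aemeasurable,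
        (hf.comp (measurable_pi_apply 0)).aemeasurable, ?_⟩
      have : ∀ i, Measure.map (fun x : ℕ → Bool => f (x i)) (Measure.infinitePi (fun _ : ℕ => bm w))
          = Measure.map f (bm w) := by
        intro i
        have h2 := Measure.infinitePi_map_eval (fun _ : ℕ => bm w) i
        have h3 := Measure.map_map (μ := Measure.infinitePi (fun _ : ℕ => bm w)) hf
          (measurable_pi_apply i)
        rw [h2] at h3
        exact h3.symm
      rw [this, this])
  have hI : ∫ x, f (x 0) ∂(Measure.infinitePi (fun _ : ℕ => bm w))
      = w * f false + (1 - w) * f true := by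
    have h1 := integral_map (μ := Measure.infinitePi (fun _ : ℕ => bm w))
      (φ := fun x : ℕ → Bool => x 0) (measurable_pi_apply 0).aemeasurable (f := f)
      hf.aestronglyMeasurable
    rw [← h1]
    have h2 : Measure.map (fun x : ℕ → Bool => x 0) (Measure.infinitePi (fun _ : ℕ => bm w)) = bm w :=
      Measure.infinitePi_map_eval (fun _ : ℕ => bm w) 0
    rw [h2, integral_fintype hfi]
    simp only [Fintype.sum_bool, Measure.real, bm_singleton, bw]
    simp [ENNReal.toReal_ofReal hw.1.le, ENNReal.toReal_ofReal (sub_nonneg.2 hw.2.le)]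
    ring
  rw [hI] at h
  exact h

lemma dim_eq {w : ℝ} (hw : w ∈ Set.Ioo (0:ℝ) 1) {s : ℝ} (hs : 0 ≤ s) (A : Set (ℕ → Bool))
    (hA : ∀ x ∈ A, Tendsto (fun n : ℕ => gG w x n / n) atTop (𝓝 s))
    (hν : ∀ᵐ x ∂(Measure.infinitePi (fun _ : ℕ => bm w)), x ∈ A) :
    dimH A = ENNReal.ofReal s := by
  have := bm_prob hw
  apply le_antisymm
  · apply le_of_forall_gt_imp_ge_of_dense
    intro b hb
    obtain ⟨t, ht1, ht2⟩ := ENNReal.lt_iff_exists_nnreal_btwn.1 hb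
    refine le_trans ?_ ht2.le
    have hst : s < t := by
      rw [← ENNReal.ofReal_coe_nnreal] at ht1
      exact (ENNReal.ofReal_lt_ofReal_iff_of_nonneg hs).1 ht1
    have ht0 : 0 < t := by exact_mod_cast hs.trans_lt hst
    have hsub : A ⊆ ⋃ N : ℕ, {x | ∀ n ≥ N, gG w x n ≤ n * t} := by
      intro x hx
      obtain ⟨N, hN⟩ := eventually_atTop.1 ((hA x hx).eventually_lt_const hst)
      refine mem_iUnion.2 ⟨N + 1, fun n hn => ?_⟩
      have hn0 : (0:ℝ) < n := by exact_mod_cast (by omega : 0 < n)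
      have := hN n (by omega)
      rw [div_lt_iff₀ hn0] at this
      linarith
    refine (dimH_mono hsub).trans ?_
    rw [dimH_iUnion]
    exact iSup_le fun N => upper hw ht0 N
  · apply le_of_forall_lt_imp_le_of_dense
    intro b hb
    obtain ⟨t, ht1, ht2⟩ := ENNReal.lt_iff_exists_nnreal_btwn.1 hb
    refine le_trans ht1.le ?_
    have hst : (t:ℝ) < s := by
      rw [← ENNReal.ofReal_coe_nnreal] at ht2
      exact (ENNReal.ofReal_lt_ofReal_iff_of_nonneg t.2).1 ht2
    have ht0 : 0 < t := by
      have := (zero_le (a := b)).trans_lt ht1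
      exact_mod_cast this
    by_contra hlt
    have hsub : A ⊆ ⋃ N : ℕ, A ∩ {x | ∀ n ≥ N, n * t ≤ gG w x n} := by
      intro x hx
      obtain ⟨N, hN⟩ := eventually_atTop.1 ((hA x hx).eventually_const_lt hst)
      refine mem_iUnion.2 ⟨N + 1, hx, fun n hn => ?_⟩
      have hn0 : (0:ℝ) < n := by exact_mod_cast (by omega : 0 < n)
      have := hN n (by omega)
      rw [lt_div_iff₀ hn0] at this
      linarith
    have hz : Measure.infinitePi (fun _ : ℕ => bm w) A = 0 := by
      refine measure_mono_null hsub (measure_iUnion_null fun N => ?_)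
      by_contra hne
      exact hlt ((lower hw ht0 N _ inter_subset_right hne).trans (dimH_mono inter_subset_left))
    have h1 : ∀ᵐ x ∂(Measure.infinitePi (fun _ : ℕ => bm w)), x ∉ A := measure_eq_zero_iff_ae_notMem.1 hz
    obtain ⟨x, hx, hx'⟩ := (hν.and h1).exists
    exact hx' hx

lemma tauP_cont (q : ℝ) {p₀ : ℝ} (hp₀ : p₀ ∈ Set.Ioo (0:ℝ) 1) :
    ContinuousAt (fun p => tauP p q) p₀ := by
  have h1 : 0 < p₀ := hp₀.1
  have h2 : 0 < 1 - p₀ := sub_pos.2 hp₀.2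
  unfold tauP Real.logb
  apply ContinuousAt.div_const
  apply ContinuousAt.log
  · apply ContinuousAt.add
    · exact continuousAt_id.rpow_const (Or.inl h1.ne')
    · exact (continuousAt_const.sub continuousAt_id).rpow_const (Or.inl h2.ne')
  · positivity

lemma tauN_tendsto (p : ℕ → ℝ) (p₀ : ℝ) (hp₀ : p₀ ∈ Set.Ioo (0:ℝ) 1)
    (hlim : Filter.Tendsto p Filter.atTop (nhds p₀)) (q : ℝ) :
    Filter.Tendsto (fun n => tauN p n q) Filter.atTop (nhds (tauP p₀ q)) := by
  have h := ((tauP_cont q hp₀).tendsto.comp hlim).cesaro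
  simpa [tauN, one_div] using h

/-- tilted weight -/
noncomputable def wq (p q : ℝ) : ℝ := p ^ q / (p ^ q + (1 - p) ^ q)

lemma wq_mem {p : ℝ} (hp : p ∈ Set.Ioo (0:ℝ) 1) (q : ℝ) : wq p q ∈ Set.Ioo (0:ℝ) 1 := by
  have h1 : 0 < p := hp.1
  have h2 : 0 < 1 - p := sub_pos.2 hp.2
  have h3 : 0 < p ^ q := by positivity
  have h4 : 0 < (1 - p) ^ q := by positivity
  unfold wq
  refine ⟨by positivity, ?_⟩
  rw [div_lt_one (by positivity)]
  linarith

lemma bw_wq {p : ℝ} (hp : p ∈ Set.Ioo (0:ℝ) 1) (q : ℝ) (b : Bool) :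
    bw (wq p q) b = (bw p b) ^ q / (p ^ q + (1 - p) ^ q) := by
  have h1 : 0 < p := hp.1
  have h2 : 0 < 1 - p := sub_pos.2 hp.2
  have h3 : 0 < p ^ q := by positivity
  have h4 : 0 < (1 - p) ^ q := by positivity
  cases b
  · simp [bw, wq]
  · simp only [bw, wq, if_true]
    field_simp
    ring

lemma logb_bw_wq {p : ℝ} (hp : p ∈ Set.Ioo (0:ℝ) 1) (q : ℝ) (b : Bool) :
    -Real.logb 2 (bw (wq p q) b) = q * (-Real.logb 2 (bw p b)) + tauP p q := by
  have h1 : 0 < p := hp.1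
  have h2 : 0 < 1 - p := sub_pos.2 hp.2
  have hb := bw_pos hp b
  rw [bw_wq hp, Real.logb_div (by positivity) (by positivity), Real.logb_rpow_eq_mul_logb_of_pos hb,
    tauP]
  ring

/-- the exponent -/
noncomputable def al (p q : ℝ) : ℝ :=
  wq p q * (-Real.logb 2 (bw p false)) + (1 - wq p q) * (-Real.logb 2 (bw p true))

lemma deriv_tauP {p : ℝ} (hp : p ∈ Set.Ioo (0:ℝ) 1) (q : ℝ) : -(deriv (tauP p) q) = al p q := by
  have h1 : 0 < p := hp.1
  have h2 : 0 < 1 - p := sub_pos.2 hp.2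
  have hd : HasDerivAt (tauP p)
      ((p ^ q * Real.log p + (1 - p) ^ q * Real.log (1 - p)) / (p ^ q + (1 - p) ^ q)
        / Real.log 2) q := by
    have ha := (Real.hasStrictDerivAt_const_rpow h1 q).hasDerivAt
    have hb := (Real.hasStrictDerivAt_const_rpow h2 q).hasDerivAt
    exact ((ha.add hb).log (by simp only [Pi.add_apply]; positivity)).div_const _
  rw [hd.deriv]
  have hl : 0 < Real.log 2 := Real.log_pos (by norm_num)
  have h3 : 0 < p ^ q := by positivity
  have h4 : 0 < (1 - p) ^ q := by positivity
  simp only [al, wq, bw, Real.logb, if_true, Bool.false_eq_true, if_false]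
  field_simp
  ring

lemma tangent {p : ℝ} (hp : p ∈ Set.Ioo (0:ℝ) 1) (q q' : ℝ) :
    al p q * q + tauP p q ≤ al p q * q' + tauP p q' := by
  have h1 : 0 < p := hp.1
  have h2 : 0 < 1 - p := sub_pos.2 hp.2
  have hw := wq_mem hp q
  have hl : 0 < Real.log 2 := Real.log_pos (by norm_num)
  have h3 : 0 < p ^ q := by positivity
  have h4 : 0 < (1 - p) ^ q := by positivity
  have hw1 : 0 < 1 - wq p q := sub_pos.2 hw.2
  have hw0 := hw.1
  have am := Real.geom_mean_le_arith_mean2_weighted hw.1.le hw1.le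
    (p₁ := p ^ (q' - q)) (p₂ := (1 - p) ^ (q' - q)) (by positivity) (by positivity) (by ring)
  have hR : wq p q * p ^ (q' - q) + (1 - wq p q) * (1 - p) ^ (q' - q)
      = (p ^ q' + (1 - p) ^ q') / (p ^ q + (1 - p) ^ q) := by
    have e : 1 - wq p q = (1 - p) ^ q / (p ^ q + (1 - p) ^ q) := by
      have := bw_wq hp q true
      simpa [bw] using this
    rw [e, wq, Real.rpow_sub h1, Real.rpow_sub h2]
    field_simp
  rw [hR] at am
  have lm := Real.logb_le_logb_of_le (b := 2) (by norm_num) (by positivity) am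
  rw [Real.logb_mul (by positivity) (by positivity), Real.logb_div (by positivity) (by positivity),
    Real.logb_rpow_eq_mul_logb_of_pos (by positivity),
    Real.logb_rpow_eq_mul_logb_of_pos h1, Real.logb_rpow_eq_mul_logb_of_pos (by positivity),
    Real.logb_rpow_eq_mul_logb_of_pos h2] at lm
  simp only [al, bw, tauP, if_true, Bool.false_eq_true, if_false]
  nlinarith [lm]

lemma s_nonneg {p : ℝ} (hp : p ∈ Set.Ioo (0:ℝ) 1) (q : ℝ) : 0 ≤ al p q * q + tauP p q := by
  have hw := wq_mem hp q
  have e : al p q * q + tauP p q = wq p q * (-Real.logb 2 (bw (wq p q) false))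
      + (1 - wq p q) * (-Real.logb 2 (bw (wq p q) true)) := by
    rw [logb_bw_wq hp, logb_bw_wq hp, al]; ring
  have hn : ∀ b, 0 ≤ -Real.logb 2 (bw (wq p q) b) := by
    intro b
    rw [neg_nonneg]
    apply Real.logb_nonpos (by norm_num) (bw_pos hw b).le
    unfold bw; split_ifs <;> linarith [hw.1, hw.2]
  rw [e]
  have := mul_nonneg hw.1.le (hn false)
  have := mul_nonneg (sub_nonneg.2 hw.2.le) (hn true)
  linarith

lemma alphaN_eq (p : ℕ → ℝ) (hp : ∀ k, p k ∈ Set.Ioo (0:ℝ) 1)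
    (μ : Measure (ℕ → Bool)) (hμ : IsBernoulli μ p) (x : ℕ → Bool) (n : ℕ) :
    alphaN μ x n = (∑ k ∈ Finset.range n, -Real.logb 2 (bw (p k) (x k))) / n := by
  have hμ' : μ (cyl x n) = ENNReal.ofReal (∏ j ∈ Finset.range n, bw (p j) (x j)) := hμ n x
  rw [alphaN, hμ', ENNReal.toReal_ofReal (Finset.prod_nonneg fun i _ => (bw_pos (hp i) _).le),
    Real.log_prod (fun i _ => (bw_pos (hp i) _).ne'), Finset.sum_neg_distrib]
  simp only [Real.logb]
  rw [← Finset.sum_div, ← neg_div, div_div, mul_comm (n:ℝ)]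

lemma diff_tendsto (p : ℕ → ℝ) (hp : ∀ k, p k ∈ Set.Ioo (0:ℝ) 1)
    (μ : Measure (ℕ → Bool)) (hμ : IsBernoulli μ p)
    (p₀ : ℝ) (hp₀ : p₀ ∈ Set.Ioo (0:ℝ) 1)
    (hlim : Filter.Tendsto p Filter.atTop (nhds p₀)) (x : ℕ → Bool) :
    Tendsto (fun n => alphaN μ x n - gG p₀ x n / n) atTop (𝓝 0) := by
  have hb : ∀ b, Tendsto (fun k => |-Real.logb 2 (bw (p k) b) - -Real.logb 2 (bw p₀ b)|)
      atTop (𝓝 0) := by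
    intro b
    have h1 : Tendsto (fun k => bw (p k) b) atTop (𝓝 (bw p₀ b)) := by
      cases b
      · simpa [bw] using hlim
      · simpa [bw] using hlim.const_sub 1
    have h2 : Tendsto (fun k => Real.logb 2 (bw (p k) b)) atTop (𝓝 (Real.logb 2 (bw p₀ b))) :=
      (h1.log (bw_pos hp₀ b).ne').div_const _
    have h3 := (h2.neg.sub_const (-Real.logb 2 (bw p₀ b))).abs
    simpa using h3
  have h0 : Tendsto (fun k => -Real.logb 2 (bw (p k) (x k)) - -Real.logb 2 (bw p₀ (x k)))
      atTop (𝓝 0) := by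
    have hs := (hb false).add (hb true)
    rw [add_zero] at hs
    refine squeeze_zero_norm (fun k => ?_) hs
    rw [Real.norm_eq_abs]
    cases x k
    · exact le_add_of_nonneg_right (abs_nonneg _)
    · exact le_add_of_nonneg_left (abs_nonneg _)
  refine h0.cesaro.congr fun n => ?_
  rw [alphaN_eq p hp μ hμ, gG, ← sub_div, ← Finset.sum_sub_distrib, inv_mul_eq_div]

lemma gG_bdd (p₀ : ℝ) (x : ℕ → Bool) (n : ℕ) :
    |gG p₀ x n / n| ≤ |Real.logb 2 (bw p₀ false)| + |Real.logb 2 (bw p₀ true)| := by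
  set M := |Real.logb 2 (bw p₀ false)| + |Real.logb 2 (bw p₀ true)| with hM
  have hM0 : 0 ≤ M := by positivity
  have : |gG p₀ x n| ≤ n * M := by
    unfold gG
    refine (Finset.abs_sum_le_sum_abs _ _).trans ?_
    refine (Finset.sum_le_card_nsmul _ _ M fun k _ => ?_).trans (by simp)
    rw [abs_neg]
    cases x k
    · exact le_add_of_nonneg_right (abs_nonneg _)
    · exact le_add_of_nonneg_left (abs_nonneg _)
  rw [abs_div, Nat.abs_cast]
  exact div_le_of_le_mul₀ (by positivity) hM0 (by linarith)

lemma mem_iff (p : ℕ → ℝ) (hp : ∀ k, p k ∈ Set.Ioo (0:ℝ) 1)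
    (μ : Measure (ℕ → Bool)) (hμ : IsBernoulli μ p)
    (p₀ : ℝ) (hp₀ : p₀ ∈ Set.Ioo (0:ℝ) 1)
    (hlim : Filter.Tendsto p Filter.atTop (nhds p₀)) (x : ℕ → Bool) (α : ℝ) :
    (alphaDim μ x = α ∧ Filter.limsup (fun n => alphaN μ x n) Filter.atTop = α) ↔
      Tendsto (fun n : ℕ => gG p₀ x n / n) atTop (𝓝 α) := by
  have hd := diff_tendsto p hp μ hμ p₀ hp₀ hlim x
  have hab : ∀ᶠ n in atTop, |alphaN μ x n| ≤
      |Real.logb 2 (bw p₀ false)| + |Real.logb 2 (bw p₀ true)| + 1 := by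
    have := hd.abs
    rw [abs_zero] at this
    filter_upwards [this.eventually_lt_const one_pos] with n hn
    have h1 := gG_bdd p₀ x n
    have h2 := abs_add_le (alphaN μ x n - gG p₀ x n / n) (gG p₀ x n / n)
    rw [sub_add_cancel] at h2
    linarith
  constructor
  · rintro ⟨h1, h2⟩
    have ht := tendsto_of_liminf_eq_limsup h1 h2
      (isBoundedUnder_of_eventually_le (hab.mono fun n hn => (abs_le.1 hn).2))
      (isBoundedUnder_of_eventually_ge (hab.mono fun n hn => (abs_le.1 hn).1))
    have := ht.sub hd
    simpa using this
  · intro h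
    have ht : Tendsto (fun n => alphaN μ x n) atTop (𝓝 α) := by
      have := hd.add h
      simpa using this
    exact ⟨ht.liminf_eq, ht.limsup_eq⟩

lemma gG_wq {p : ℝ} (hp : p ∈ Set.Ioo (0:ℝ) 1) (q : ℝ) (x : ℕ → Bool) (n : ℕ) :
    gG (wq p q) x n = q * gG p x n + n * tauP p q := by
  unfold gG
  simp only [logb_bw_wq hp]
  rw [Finset.sum_add_distrib, ← Finset.mul_sum]
  simp

/-- **Corollary 1.3.** If `p_n → p ∈ (0,1)`, then `τ_n(q) → τ(p,q)` for every `q`,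
so `τ = τ(p,·)`, and `μ` satisfies the multifractal formalism: for every `q`, with
`α = -∂_q τ(p,q)`, `dim(E_α ∩ F_α) = τ*(α) = α q + τ(p,q)`. -/
theorem stmt2 (p : ℕ → ℝ) (hp : ∀ k, p k ∈ Set.Ioo (0:ℝ) 1)
    (μ : Measure (ℕ → Bool)) [IsProbabilityMeasure μ] (hμ : IsBernoulli μ p)
    (p₀ : ℝ) (hp₀ : p₀ ∈ Set.Ioo (0:ℝ) 1)
    (hlim : Filter.Tendsto p Filter.atTop (nhds p₀)) :
    (∀ q : ℝ, Filter.Tendsto (fun n => tauN p n q) Filter.atTop (nhds (tauP p₀ q))) ∧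
    (∀ q : ℝ, tauLq p q = tauP p₀ q) ∧
    (∀ q : ℝ,
      dimH ({x | alphaDim μ x = -(deriv (tauP p₀) q)} ∩
          {x | Filter.limsup (fun n => alphaN μ x n) Filter.atTop = -(deriv (tauP p₀) q)})
        = ENNReal.ofReal (tauStar p (-(deriv (tauP p₀) q))) ∧
      tauStar p (-(deriv (tauP p₀) q)) = -(deriv (tauP p₀) q) * q + tauP p₀ q) := by
  have hT := fun q => tauN_tendsto p p₀ hp₀ hlim q
  have hL : ∀ q : ℝ, tauLq p q = tauP p₀ q := fun q => (hT q).limsup_eq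
  refine ⟨hT, hL, fun q => ?_⟩
  rw [deriv_tauP hp₀]
  have hstar : tauStar p (al p₀ q) = al p₀ q * q + tauP p₀ q := by
    unfold tauStar
    simp only [hL]
    apply le_antisymm
    · refine ciInf_le ⟨al p₀ q * q + tauP p₀ q, ?_⟩ q
      rintro _ ⟨q', rfl⟩
      exact tangent hp₀ q q'
    · exact le_ciInf fun q' => tangent hp₀ q q'
  refine ⟨?_, hstar⟩
  rw [hstar]
  apply dim_eq (wq_mem hp₀ q) (s_nonneg hp₀ q)
  · intro x hx
    have h := (mem_iff p hp μ hμ p₀ hp₀ hlim x _).1 hx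
    have h2 := (h.const_mul q).add_const (tauP p₀ q)
    rw [mul_comm q] at h2
    refine h2.congr' ?_
    filter_upwards [eventually_gt_atTop 0] with n hn
    have hn0 : (n:ℝ) ≠ 0 := by exact_mod_cast hn.ne'
    rw [gG_wq hp₀]
    field_simp
  · filter_upwards [slln (wq_mem hp₀ q) (fun b => -Real.logb 2 (bw p₀ b))] with x hx
    exact (mem_iff p hp μ hμ p₀ hp₀ hlim x _).2 hx
end

section
/- There exists a sequence (p_n)_{n≥1} with p_n ∈ (0,1) such that the L^q-spectrum τ(q) = limsup_{n→∞} (1/n) ∑_{k=1}^n log₂(p_k^q + (1−p_k)^q) of the associated inhomogeneous Bernoulli product has a dense set of phase transitions in (1,∞): the set { q ∈ (1,∞) : τ is not differentiable at q } is dense in (1,∞). -/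
open MeasureTheory Filter Set
open scoped Topology ENNReal NNReal Classical

lemma tauP_half (q : ℝ) : tauP (1/2) q = 1 - q := by
  unfold tauP
  have h : ((1:ℝ)/2) ^ q + (1 - 1/2) ^ q = 2 ^ (1 - q) := by
    have : (1:ℝ) - 1/2 = 1/2 := by norm_num
    rw [this, Real.rpow_sub (by norm_num), Real.div_rpow (by norm_num) (by norm_num)]
    simp; ring
  rw [h, Real.logb_rpow (by norm_num) (by norm_num)]

lemma tauP_nonpos {p q : ℝ} (hp : p ∈ Set.Ioo (0:ℝ) 1) (hq : 1 < q) : tauP p q ≤ 0 := by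
  obtain ⟨h0, h1⟩ := hp
  unfold tauP
  have a1 : p ^ q ≤ p := by
    simpa using Real.rpow_le_rpow_of_exponent_ge h0 h1.le hq.le
  have a2 : (1-p) ^ q ≤ 1-p := by
    simpa using Real.rpow_le_rpow_of_exponent_ge (by linarith : 0 < 1 - p) (by linarith) hq.le
  have b1 : 0 < p ^ q := Real.rpow_pos_of_pos h0 q
  have b2 : 0 < (1-p) ^ q := Real.rpow_pos_of_pos (by linarith) q
  exact Real.logb_nonpos (by norm_num) (by linarith) (by linarith)

lemma tauP_lower {p q : ℝ} (hp : p ∈ Set.Ioo (0:ℝ) 1) (hq : 1 < q) : -q ≤ tauP p q := by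
  obtain ⟨h0, h1⟩ := hp
  unfold tauP
  have b1 : 0 < p ^ q := Real.rpow_pos_of_pos h0 q
  have b2 : 0 < (1-p) ^ q := Real.rpow_pos_of_pos (by linarith) q
  rw [Real.le_logb_iff_rpow_le (by norm_num) (by linarith)]
  have e : (2:ℝ) ^ (-q) = (1/2) ^ q := by
    rw [Real.rpow_neg (by norm_num), Real.div_rpow (by norm_num) (by norm_num)]; simp
  rw [e]
  rcases le_total p (1/2) with h | h
  · have := Real.rpow_le_rpow (by norm_num : (0:ℝ) ≤ 1/2) (by linarith : 1/2 ≤ 1 - p) (by linarith : 0 ≤ q)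
    linarith
  · have := Real.rpow_le_rpow (by norm_num : (0:ℝ) ≤ 1/2) h (by linarith : 0 ≤ q)
    linarith

lemma tauP_small {q : ℝ} (hq : 1 < q) :
    Tendsto (fun k : ℕ => tauP (1 / ((k:ℝ) + 2)) q) atTop (𝓝 0) := by
  have h1 : Tendsto (fun k : ℕ => 1 / ((k:ℝ) + 2)) atTop (𝓝 0) := by
    have : Tendsto (fun k : ℕ => (k:ℝ) + 2) atTop atTop :=
      tendsto_atTop_add_const_right _ _ tendsto_natCast_atTop_atTop
    simp only [one_div]
    exact this.inv_tendsto_atTop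
  have hc : ContinuousAt (fun p : ℝ => tauP p q) 0 := by
    unfold tauP Real.logb
    have hq0 : 0 ≤ q := by linarith
    have : ContinuousAt (fun p : ℝ => p ^ q + (1 - p) ^ q) 0 := by
      apply ContinuousAt.add
      · exact (Real.continuous_rpow_const hq0).continuousAt
      · exact ((Real.continuous_rpow_const hq0).comp (continuous_const.sub continuous_id)).continuousAt
    refine (this.log ?_).div_const _
    have : q ≠ 0 := by linarith
    simp [Real.zero_rpow this]
  have h0 : tauP 0 q = 0 := by
    have : q ≠ 0 := by linarith
    simp [tauP, Real.zero_rpow this]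
  have := hc.tendsto.comp h1
  rw [h0] at this
  exact this

lemma third_deriv {q : ℝ} (hq : 1 < q) :
    ∃ d, HasDerivAt (tauP (1/3)) d q ∧ 0 < d * (q - 1) - tauP (1/3) q := by
  set x : ℝ := (1/3:ℝ) ^ q with hx
  set y : ℝ := (1 - 1/3:ℝ) ^ q with hy
  have x0 : 0 < x := Real.rpow_pos_of_pos (by norm_num) q
  have y0 : 0 < y := Real.rpow_pos_of_pos (by norm_num) q
  set lp := Real.log (1/3:ℝ) with hlp
  set lr := Real.log (1 - 1/3:ℝ) with hlr
  have l2 : 0 < Real.log 2 := Real.log_pos (by norm_num)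
  refine ⟨(x * lp + y * lr) / (x + y) / Real.log 2, ?_, ?_⟩
  · have d1 : HasDerivAt (fun q : ℝ => (1/3:ℝ) ^ q) (x * lp) q :=
      (Real.hasStrictDerivAt_const_rpow (by norm_num) q).hasDerivAt
    have d2 : HasDerivAt (fun q : ℝ => (1-1/3:ℝ) ^ q) (y * lr) q :=
      (Real.hasStrictDerivAt_const_rpow (by norm_num) q).hasDerivAt
    exact ((d1.add d2).log (show x + y ≠ 0 by positivity)).div_const _
  · have hJ : Real.exp ((x/(x+y)) * ((1-q)*lp) + (y/(x+y)) * ((1-q)*lr)) < 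
        (x/(x+y)) * Real.exp ((1-q)*lp) + (y/(x+y)) * Real.exp ((1-q)*lr) := by
      have hne : (1-q)*lp ≠ (1-q)*lr := by
        have : lp < lr := Real.log_lt_log (by norm_num) (by norm_num)
        intro h
        have := mul_left_cancel₀ (by linarith) h
        linarith
      exact strictConvexOn_exp.2 (mem_univ _) (mem_univ _) hne (by positivity) (by positivity)
        (by field_simp)
    have e1 : x * Real.exp ((1-q)*lp) = 1/3 := by
      rw [hx, Real.rpow_def_of_pos (by norm_num), ← Real.exp_add, ← hlp,
        show lp * q + (1-q) * lp = lp by ring, hlp, Real.exp_log (by norm_num)]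
    have e2 : y * Real.exp ((1-q)*lr) = 1 - 1/3 := by
      rw [hy, Real.rpow_def_of_pos (by norm_num), ← Real.exp_add, ← hlr,
        show lr * q + (1-q) * lr = lr by ring, hlr, Real.exp_log (by norm_num)]
    have e3 : (x/(x+y)) * Real.exp ((1-q)*lp) + (y/(x+y)) * Real.exp ((1-q)*lr) = (x+y)⁻¹ := by
      have : (x/(x+y)) * Real.exp ((1-q)*lp) + (y/(x+y)) * Real.exp ((1-q)*lr)
        = (x * Real.exp ((1-q)*lp) + y * Real.exp ((1-q)*lr)) / (x+y) := by ring
      rw [this, e1, e2]; norm_num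
    rw [e3, ← Real.lt_log_iff_exp_lt (by positivity), Real.log_inv] at hJ
    have : tauP (1/3) q = Real.log (x+y) / Real.log 2 := rfl
    rw [this]
    have e4 : (x * lp + y * lr) / (x + y) / Real.log 2 * (q-1) - Real.log (x+y) / Real.log 2
      = (-Real.log (x+y) - (x / (x + y) * ((1 - q) * lp) + y / (x + y) * ((1 - q) * lr))) / Real.log 2 := by
      ring
    rw [e4]
    exact div_pos (by linarith) l2

lemma family : ∃ (a b u : ℕ → ℝ), (∀ m, a m ∈ Set.Icc (0:ℝ) 1) ∧ (∀ m, b m ∈ Set.Icc (0:ℝ) 1) ∧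
    (∀ s t : ℝ, 0 ≤ s → s < t → ∃ i, u i ∈ Set.Ioo s t) ∧
    (∀ i, ∃ m n, b m ≠ b n ∧ ∀ k, a m + b m * u i ≤ a k + b k * u i ∧
      a n + b n * u i ≤ a k + b k * u i) := by
  set u : ℕ → ℝ := fun k => |TopologicalSpace.denseSeq ℝ k| with hu
  set w : ℕ → ℝ := fun k => (1/2) ^ (k+1) / (1 + u k) with hw
  have u0 : ∀ k, 0 ≤ u k := fun k => abs_nonneg _
  have w0 : ∀ k, 0 < w k := fun k => by have := u0 k; positivity
  have hs : HasSum (fun k : ℕ => ((1:ℝ)/2) ^ (k+1)) 1 := by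
    have := (hasSum_geometric_two).mul_left (1/2)
    simpa [pow_succ, mul_comm] using this
  have w1 : ∀ k, w k ≤ (1/2) ^ (k+1) := fun k => by
    have := u0 k
    exact div_le_self (by positivity) (by linarith)
  have wu1 : ∀ k, w k * u k ≤ (1/2) ^ (k+1) := fun k => by
    have := u0 k
    have h : w k * u k = (1/2) ^ (k+1) * (u k / (1 + u k)) := by simp only [hw]; ring
    rw [h]
    apply mul_le_of_le_one_right (by positivity)
    rw [div_le_one (by positivity)]; linarith
  set S : ℕ → Set ℕ := fun m => if (Nat.unpair m).2 = 0 then {k | u (Nat.unpair m).1 ≤ u k}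
    else {k | u (Nat.unpair m).1 < u k} with hS
  set fa : ℕ → ℕ → ℝ := fun m k => if k ∈ S m then 0 else w k * u k with hfa
  set fb : ℕ → ℕ → ℝ := fun m k => if k ∈ S m then w k else 0 with hfb
  have fa0 : ∀ m k, 0 ≤ fa m k := fun m k => by
    simp only [hfa]; split_ifs
    · exact le_rfl
    · exact mul_nonneg (w0 k).le (u0 k)
  have fb0 : ∀ m k, 0 ≤ fb m k := fun m k => by
    simp only [hfb]; split_ifs
    · exact (w0 k).le
    · exact le_rfl
  have fa1 : ∀ m k, fa m k ≤ (1/2) ^ (k+1) := fun m k => by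
    simp only [hfa]; split_ifs
    · positivity
    · exact wu1 k
  have fb1 : ∀ m k, fb m k ≤ (1/2) ^ (k+1) := fun m k => by
    simp only [hfb]; split_ifs
    · exact w1 k
    · positivity
  have sa : ∀ m, Summable (fa m) := fun m => Summable.of_nonneg_of_le (fa0 m) (fa1 m) hs.summable
  have sb : ∀ m, Summable (fb m) := fun m => Summable.of_nonneg_of_le (fb0 m) (fb1 m) hs.summable
  refine ⟨fun m => ∑' k, fa m k, fun m => ∑' k, fb m k, u, ?_, ?_, ?_, ?_⟩
  · intro m
    refine ⟨tsum_nonneg (fa0 m), ?_⟩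
    rw [← hs.tsum_eq]
    exact (sa m).tsum_le_tsum (fa1 m) hs.summable
  · intro m
    refine ⟨tsum_nonneg (fb0 m), ?_⟩
    rw [← hs.tsum_eq]
    exact (sb m).tsum_le_tsum (fb1 m) hs.summable
  · intro s t h0 hst
    obtain ⟨i, hi⟩ := (TopologicalSpace.denseRange_denseSeq ℝ).exists_mem_open isOpen_Ioo
      (nonempty_Ioo.2 hst)
    refine ⟨i, ?_⟩
    have : u i = TopologicalSpace.denseSeq ℝ i := abs_of_nonneg (h0.trans hi.1.le)
    rw [this]; exact hi
  · intro i
    have S0 : S (Nat.pair i 0) = {k | u i ≤ u k} := by simp [hS]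
    have S1 : S (Nat.pair i 1) = {k | u i < u k} := by simp [hS]
    refine ⟨Nat.pair i 0, Nat.pair i 1, ?_, ?_⟩
    · apply ne_of_gt
      refine Summable.tsum_lt_tsum (i := i) ?_ ?_ (sb _) (sb _)
      · intro k
        simp only [hfb, S0, S1, mem_setOf_eq]
        split_ifs with h1 h2 h2
        · exact le_rfl
        · exact absurd h1.le h2
        · exact (w0 k).le
        · exact le_rfl
      · simp only [hfb, S0, S1, mem_setOf_eq]
        simpa using w0 i
    · have key : ∀ m, (∑' k, fa m k) + (∑' k, fb m k) * u i = ∑' k, (fa m k + fb m k * u i) := by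
        intro m
        rw [← tsum_mul_right, ← (sa m).tsum_add ((sb m).mul_right _)]
      have ss : ∀ m, Summable (fun k => fa m k + fb m k * u i) := fun m =>
        (sa m).add ((sb m).mul_right _)
      have val : ∀ m k, fa m k + fb m k * u i = w k * (if k ∈ S m then u i else u k) := by
        intro m k
        simp only [hfa, hfb]; split_ifs <;> ring
      intro m
      simp only [key]
      constructor
      · refine (ss _).tsum_le_tsum ?_ (ss _)
        intro k
        rw [val, val]
        apply mul_le_mul_of_nonneg_left _ (w0 k).le
        simp only [S0, mem_setOf_eq]
        split_ifs <;> linarith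
      · refine (ss _).tsum_le_tsum ?_ (ss _)
        intro k
        rw [val, val]
        apply mul_le_mul_of_nonneg_left _ (w0 k).le
        simp only [S1, mem_setOf_eq]
        split_ifs <;> linarith

lemma floor_step {s α : ℝ} (h0 : 0 ≤ α) (h1 : α ≤ 1) :
    ⌊s + α⌋ = ⌊s⌋ ∨ ⌊s + α⌋ = ⌊s⌋ + 1 := by
  have a1 : ⌊s⌋ ≤ ⌊s + α⌋ := Int.floor_mono (by linarith)
  have a2 : ⌊s + α⌋ ≤ ⌊s + 1⌋ := Int.floor_mono (by linarith)
  rw [Int.floor_add_one] at a2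
  omega

/-- types sequence with prescribed counts -/
lemma types (α β : ℕ → ℝ) (hα : ∀ m, α m ∈ Set.Icc (0:ℝ) 1) (hβ : ∀ m, β m ∈ Set.Icc (0:ℝ) 1) :
    ∃ p : ℕ → ℝ, (∀ k, p k ∈ Set.Ioo (0:ℝ) 1) ∧ ∀ q, 1 < q →
      Tendsto (fun n : ℕ => tauN p n q - (1 / (n:ℝ)) *
        ∑ k ∈ Finset.range (n/2), (α k * (1-q) + β k * tauP (1/3) q)) atTop (𝓝 0) := by
  set A : ℕ → ℝ := fun n => ∑ k ∈ Finset.range n, α k with hA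
  set B : ℕ → ℝ := fun n => ∑ k ∈ Finset.range n, β k with hB
  set T : ℕ → ℤ := fun n => ⌊A ((n+1)/2)⌋ with hT
  set U : ℕ → ℤ := fun n => ⌊B (n/2)⌋ with hU
  set p : ℕ → ℝ := fun k => if T k < T (k+1) then 1/2 else if U k < U (k+1) then 1/3 else
    1 / ((k:ℝ)+2) with hp
  have pm : ∀ k, p k ∈ Set.Ioo (0:ℝ) 1 := by
    intro k
    simp only [hp]
    split_ifs
    · norm_num
    · norm_num
    · constructor
      · positivity
      · rw [div_lt_one (by positivity)]
        have : (0:ℝ) ≤ k := Nat.cast_nonneg k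
        linarith
  refine ⟨p, pm, ?_⟩
  intro q hq
  set E : ℕ → ℝ := fun k => if T k < T (k+1) then 0 else if U k < U (k+1) then 0 else
    tauP (1 / ((k:ℝ)+2)) q with hE
  have step : ∀ k, tauP (p k) q = ((T (k+1) : ℝ) - T k) * (1-q)
      + ((U (k+1) : ℝ) - U k) * tauP (1/3) q + E k := by
    intro k
    rcases Nat.even_or_odd' k with ⟨j, rfl | rfl⟩
    · have i1 : (2*j+1+1)/2 = j+1 := by omega
      have i2 : (2*j+1)/2 = j := by omega
      have i3 : (2*j)/2 = j := by omega
      have hUe : U (2*j+1) = U (2*j) := by simp only [hU, i2, i3]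
      have hTe : T (2*j+1) = T (2*j) ∨ T (2*j+1) = T (2*j) + 1 := by
        simp only [hT, i1, i2]
        have : A (j+1) = A j + α j := Finset.sum_range_succ _ _
        rw [this]
        exact floor_step (hα j).1 (hα j).2
      rcases hTe with h | h
      · simp [hp, hE, h, hUe]
      · simp only [hp, hE, h, hUe]
        simp [← one_div, tauP_half]
    · have i1 : (2*j+1+1)/2 = j+1 := by omega
      have i2 : (2*j+1)/2 = j := by omega
      have i3 : (2*j+1+1+1)/2 = j+1 := by omega
      have hTe : T (2*j+1+1) = T (2*j+1) := by simp only [hT, i1, i3]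
      have hUe : U (2*j+1+1) = U (2*j+1) ∨ U (2*j+1+1) = U (2*j+1) + 1 := by
        simp only [hU, i1, i2]
        have : B (j+1) = B j + β j := Finset.sum_range_succ _ _
        rw [this]
        exact floor_step (hβ j).1 (hβ j).2
      rcases hUe with h | h
      · simp [hp, hE, h, hTe]
      · simp only [hp, hE, h, hTe]
        simp
  have E0 : Tendsto E atTop (𝓝 0) := by
    apply squeeze_zero_norm (a := fun k : ℕ => ‖tauP (1 / ((k:ℝ)+2)) q‖)
    · intro k
      simp only [hE]
      split_ifs <;> simp
    · simpa using (tauP_small hq).norm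
  have cE := E0.cesaro
  have T0 : T 0 = 0 := by simp [hT, hA]
  have U0 : U 0 = 0 := by simp [hU, hB]
  have total : ∀ n, ∑ k ∈ Finset.range n, tauP (p k) q = (T n : ℝ) * (1-q) + U n * tauP (1/3) q
      + ∑ k ∈ Finset.range n, E k := by
    intro n
    simp only [step]
    rw [Finset.sum_add_distrib, Finset.sum_add_distrib, ← Finset.sum_mul, ← Finset.sum_mul,
      Finset.sum_range_sub (fun k => (T k : ℝ)), Finset.sum_range_sub (fun k => (U k : ℝ)), T0, U0]
    simp
  have bT : ∀ n, |(T n : ℝ) - A (n/2)| ≤ 2 := by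
    intro n
    have f1 := Int.floor_le (A ((n+1)/2))
    have f2 := Int.lt_floor_add_one (A ((n+1)/2))
    have f3 : A (n/2) ≤ A ((n+1)/2) ∧ A ((n+1)/2) ≤ A (n/2) + 1 := by
      rcases (by omega : (n+1)/2 = n/2 ∨ (n+1)/2 = n/2+1) with h | h
      · rw [h]; constructor <;> linarith
      · have : A (n/2+1) = A (n/2) + α (n/2) := Finset.sum_range_succ _ _
        have h' := hα (n/2)
        rw [h, this]; constructor <;> linarith [h'.1, h'.2]
    rw [abs_le]
    simp only [hT]
    constructor <;> linarith [f3.1, f3.2]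
  have bU : ∀ n, |(U n : ℝ) - B (n/2)| ≤ 2 := by
    intro n
    have f1 := Int.floor_le (B (n/2))
    have f2 := Int.lt_floor_add_one (B (n/2))
    rw [abs_le]
    simp only [hU]
    constructor <;> linarith
  have split : ∀ n : ℕ, tauN p n q - (1 / (n:ℝ)) *
        ∑ k ∈ Finset.range (n/2), (α k * (1-q) + β k * tauP (1/3) q)
      = (1 / (n:ℝ)) * (((T n : ℝ) - A (n/2)) * (1-q) + ((U n : ℝ) - B (n/2)) * tauP (1/3) q)
        + (n:ℝ)⁻¹ * ∑ k ∈ Finset.range n, E k := by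
    intro n
    unfold tauN
    rw [total, Finset.sum_add_distrib, ← Finset.sum_mul, ← Finset.sum_mul]
    simp only [hA, hB]
    ring
  simp only [split]
  rw [show (0:ℝ) = 0 + 0 by ring]
  refine Tendsto.add ?_ cE
  apply squeeze_zero_norm (a := fun n : ℕ => (1/(n:ℝ)) * (2 * |1-q| + 2 * |tauP (1/3) q|))
  · intro n
    rw [norm_mul, Real.norm_eq_abs, Real.norm_eq_abs, abs_of_nonneg (by positivity : 0 ≤ 1/(n:ℝ))]
    apply mul_le_mul_of_nonneg_left _ (by positivity)
    refine (abs_add_le _ _).trans ?_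
    rw [abs_mul, abs_mul]
    exact add_le_add (mul_le_mul_of_nonneg_right (bT n) (abs_nonneg _))
      (mul_le_mul_of_nonneg_right (bU n) (abs_nonneg _))
  · simpa using (tendsto_one_div_atTop_nhds_zero_nat (𝕜 := ℝ)).mul_const (2 * |1-q| + 2 * |tauP (1/3) q|)

lemma realize (a b : ℕ → ℝ) (ha : ∀ m, a m ∈ Set.Icc (0:ℝ) 1) (hb : ∀ m, b m ∈ Set.Icc (0:ℝ) 1) :
    ∃ p : ℕ → ℝ, (∀ k, p k ∈ Set.Ioo (0:ℝ) 1) ∧ ∀ q, 1 < q →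
      (∀ m, (a m * (1-q) + b m * tauP (1/3) q) / 2 ≤ tauLq p q) ∧
      (∀ i, (∀ m, a m * (1-q) + b m * tauP (1/3) q ≤ a i * (1-q) + b i * tauP (1/3) q) →
        tauLq p q ≤ (a i * (1-q) + b i * tauP (1/3) q) / 2) := by
  set J : ℕ → ℕ := fun k => (Nat.unpair (Nat.log 2 (Nat.log 2 k))).1 with hJ
  obtain ⟨p, pm, hp⟩ := types (fun k => a (J k)) (fun k => b (J k)) (fun _ => ha _) (fun _ => hb _)
  refine ⟨p, pm, ?_⟩
  intro q hq
  have h := hp q hq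
  set F : ℕ → ℝ := fun m => a m * (1-q) + b m * tauP (1/3) q with hF
  have hf := tauP_nonpos (p := 1/3) (by norm_num) hq
  have F0 : ∀ m, F m ≤ 0 := by
    intro m
    have h1 := ha m
    have h2 := hb m
    simp only [hF]
    nlinarith [h1.1, h2.1]
  set C : ℝ := (q - 1) - tauP (1/3) q with hC
  have C0 : 0 ≤ C := by simp only [hC]; linarith
  have FC : ∀ m, -C ≤ F m := by
    intro m
    have h1 := ha m
    have h2 := hb m
    simp only [hF, hC]
    nlinarith [h1.2, h2.2]
  change Tendsto (fun n : ℕ => tauN p n q - (1 / (n:ℝ)) * ∑ k ∈ Finset.range (n/2), F (J k)) atTop (𝓝 0) at h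
  have nb : ∀ n, tauN p n q ≤ 0 := by
    intro n
    unfold tauN
    exact mul_nonpos_of_nonneg_of_nonpos (by positivity) (Finset.sum_nonpos fun k _ => tauP_nonpos (pm k) hq)
  have nl : ∀ n, -q ≤ tauN p n q := by
    intro n
    unfold tauN
    rcases Nat.eq_zero_or_pos n with rfl | hn
    · simp; linarith
    · have : (n:ℝ) * (-q) ≤ ∑ k ∈ Finset.range n, tauP (p k) q := by
        have := Finset.card_nsmul_le_sum (Finset.range n) (fun k => tauP (p k) q) (-q)
          (fun k _ => tauP_lower (pm k) hq)
        simpa using this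
      have hn' : (0:ℝ) < n := by exact_mod_cast hn
      rw [one_div, ← div_eq_inv_mul, le_div_iff₀ hn']
      linarith
  have bdA : IsBoundedUnder (· ≤ ·) atTop (fun n => tauN p n q) :=
    isBoundedUnder_of ⟨0, nb⟩
  have bdB : IsBoundedUnder (· ≥ ·) atTop (fun n => tauN p n q) :=
    isBoundedUnder_of ⟨-q, nl⟩
  constructor
  · intro m
    change F m / 2 ≤ _
    apply le_of_forall_pos_le_add
    intro ε hε
    rw [← sub_le_iff_le_add]
    refine le_limsup_of_frequently_le ?_ bdA
    -- stage points
    set φ : ℕ → ℕ := fun l => Nat.pair m l with hφ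
    set ψ : ℕ → ℕ := fun l => 2 * 2 ^ (2 ^ (φ l + 1)) with hψ
    have φle : ∀ l, l ≤ φ l := fun l => Nat.right_le_pair m l
    have φt : Tendsto φ atTop atTop := tendsto_atTop_mono φle tendsto_id
    have Pt : Tendsto (fun l => 2 ^ (2 ^ (φ l))) atTop atTop := by
      refine tendsto_atTop_mono (fun l => ?_) φt
      exact (Nat.lt_two_pow_self.le).trans Nat.lt_two_pow_self.le
    have ψt : Tendsto ψ atTop atTop := by
      refine tendsto_atTop_mono (fun l => ?_) Pt
      simp only [hψ]
      have : 2 ^ 2 ^ φ l ≤ 2 ^ 2 ^ (φ l + 1) :=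
        Nat.pow_le_pow_right (by norm_num) (Nat.pow_le_pow_right (by norm_num) (by omega))
      omega
    have low : ∀ l, F m / 2 - C / 2 * (1 / ((2 ^ (2 ^ (φ l)) : ℕ) : ℝ)) ≤
        (1 / (ψ l:ℝ)) * ∑ k ∈ Finset.range (ψ l/2), F (J k) := by
      intro l
      set N : ℕ := 2 ^ (2 ^ (φ l)) with hN
      have hN0 : 0 < N := by positivity
      have hNN : 2 ^ (2 ^ (φ l + 1)) = N * N := by
        rw [hN, ← pow_add]; congr 1; ring
      have e1 : ψ l / 2 = N * N := by simp only [hψ, hNN]; omega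
      have e2 : ψ l = 2 * (N * N) := by simp only [hψ, hNN]
      have hle : N ≤ N * N := Nat.le_mul_of_pos_left _ hN0
      have hst : ∀ k ∈ Finset.Ico N (N*N), F (J k) = F m := by
        intro k hk
        rw [Finset.mem_Ico] at hk
        have hk0 : k ≠ 0 := by omega
        have g1 : 2 ^ (φ l) ≤ Nat.log 2 k := by
          apply Nat.le_log_of_pow_le (by norm_num) hk.1
        have g2 : Nat.log 2 k < 2 ^ (φ l + 1) := by
          apply Nat.log_lt_of_lt_pow hk0
          rw [hNN]; exact hk.2
        have g3 : Nat.log 2 (Nat.log 2 k) = φ l := by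
          apply Nat.log_eq_of_pow_le_of_lt_pow g1 g2
        simp only [hJ, g3, hφ, Nat.unpair_pair]
      have s1 : (N:ℝ) * (-C) ≤ ∑ k ∈ Finset.range N, F (J k) := by
        have := Finset.card_nsmul_le_sum (Finset.range N) (fun k => F (J k)) (-C)
          (fun k _ => FC _)
        simpa using this
      have s2 : ∑ k ∈ Finset.Ico N (N*N), F (J k) = ((N:ℝ)*N - N) * F m := by
        rw [Finset.sum_congr rfl hst]
        simp [Nat.cast_sub hle]
      rw [e1, e2, ← Finset.sum_range_add_sum_Ico _ hle, s2]
      push_cast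
      have hNr : (0:ℝ) < N := by exact_mod_cast hN0
      have t1 : F m / 2 - C / 2 * (1 / (N:ℝ)) = 1 / (2 * ((N:ℝ) * N)) * (N * N * F m - N * C) := by
        field_simp
      rw [t1]
      apply mul_le_mul_of_nonneg_left _ (by positivity)
      have := F0 m
      nlinarith
    have lim0 : Tendsto (fun l => C / 2 * (1 / ((2 ^ (2 ^ (φ l)) : ℕ) : ℝ))) atTop (𝓝 0) := by
      have := ((tendsto_one_div_atTop_nhds_zero_nat (𝕜 := ℝ)).comp Pt).const_mul (C/2)
      simpa using this
    have c1 := lim0.eventually (gt_mem_nhds (show (0:ℝ) < ε/2 by linarith))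
    have c2 := (h.comp ψt).eventually (lt_mem_nhds (show -(ε/2) < (0:ℝ) by linarith))
    have : ∀ᶠ l in atTop, F m / 2 - ε ≤ tauN p (ψ l) q := by
      filter_upwards [c1, c2] with l h1 h2
      have := low l
      simp only [Function.comp] at h2
      linarith
    exact ψt.frequently this.frequently
  · intro i hi
    change ∀ m, F m ≤ F i at hi
    change _ ≤ F i / 2
    apply le_of_forall_pos_le_add
    intro ε hε
    refine limsup_le_of_le bdB.isCoboundedUnder_le ?_
    have c1 := ((tendsto_one_div_atTop_nhds_zero_nat (𝕜 := ℝ)).mul_const (-F i / 2)).eventually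
      (gt_mem_nhds (show 0 * (-F i / 2) < ε/2 by linarith))
    have c2 := h.eventually (gt_mem_nhds (show (0:ℝ) < ε/2 by linarith))
    filter_upwards [c1, c2, eventually_gt_atTop 0] with n h1 h2 hn
    have hn' : (0:ℝ) < n := by exact_mod_cast hn
    have s1 : ∑ k ∈ Finset.range (n/2), F (J k) ≤ ((n/2 : ℕ):ℝ) * F i := by
      have := Finset.sum_le_card_nsmul (Finset.range (n/2)) (fun k => F (J k)) (F i)
          (fun k _ => hi _)
      simpa using this
    have s2 : ((n:ℝ) - 1)/2 ≤ ((n/2 : ℕ):ℝ) := by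
      have : n ≤ 2 * (n/2) + 1 := by omega
      have : (n:ℝ) ≤ 2 * ((n/2:ℕ):ℝ) + 1 := by exact_mod_cast this
      linarith
    have s3 : (1/(n:ℝ)) * ∑ k ∈ Finset.range (n/2), F (J k) ≤ (1/(n:ℝ)) * (((n:ℝ) - 1)/2 * F i) := by
      apply mul_le_mul_of_nonneg_left _ (by positivity)
      have := F0 i
      nlinarith
    have s4 : (1/(n:ℝ)) * (((n:ℝ) - 1)/2 * F i) = F i / 2 + 1/(n:ℝ) * (-F i/2) := by
      field_simp
      ring
    linarith

/-- **Theorem 1.4.** There exist inhomogeneous Bernoulli products whose `L^q`-spectrum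
has a dense set of phase transitions (non-differentiability points) in `(1, ∞)`. -/
theorem stmt3 :
    ∃ p : ℕ → ℝ, (∀ k, p k ∈ Set.Ioo (0:ℝ) 1) ∧
      Set.Ioi (1:ℝ) ⊆
        closure {q : ℝ | q ∈ Set.Ioi (1:ℝ) ∧ ¬ DifferentiableAt ℝ (tauLq p) q} := by
  obtain ⟨a, b, u, ha, hb, hu, hk⟩ := family
  obtain ⟨p, pm, hp⟩ := realize a b ha hb
  refine ⟨p, pm, ?_⟩
  -- slope function
  set v : ℝ → ℝ := fun q => tauP (1/3) q / (1 - q) with hv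
  have vd : ∀ q, 1 < q → ∃ d, HasDerivAt v d q ∧ d ≠ 0 := by
    intro q hq
    obtain ⟨d, hd, hpos⟩ := third_deriv hq
    have hne : (1 - q) ≠ 0 := by linarith
    have h1 : HasDerivAt (fun q : ℝ => 1 - q) (-1) q := by
      simpa using (hasDerivAt_id q).const_sub 1
    refine ⟨_, hd.div h1 hne, ?_⟩
    apply div_ne_zero _ (pow_ne_zero _ hne)
    intro h
    linarith
  have v0 : ∀ q, 1 < q → 0 ≤ v q := fun q hq =>
    div_nonneg_of_nonpos (tauP_nonpos (by norm_num) hq) (by linarith)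
  intro x hx
  rw [mem_Ioi] at hx
  rw [Metric.mem_closure_iff]
  intro ε hε
  have vc : ContinuousOn v (Icc x (x + ε/2)) := fun q hq => by
    obtain ⟨d, hd, -⟩ := vd q (lt_of_lt_of_le hx hq.1)
    exact hd.continuousAt.continuousWithinAt
  have hvne : v x ≠ v (x + ε/2) := by
    intro h
    obtain ⟨c, hc, hc0⟩ := exists_deriv_eq_zero (by linarith : x < x + ε/2) vc h
    obtain ⟨d, hd, hd0⟩ := vd c (hx.trans hc.1)
    rw [hd.deriv] at hc0
    exact hd0 hc0
  obtain ⟨i, q, hq, hqi⟩ : ∃ i, ∃ q ∈ Icc x (x+ε/2), v q = u i := by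
    have hxe : x ≤ x + ε/2 := by linarith
    rcases lt_or_gt_of_ne hvne with h | h
    · obtain ⟨i, hi⟩ := hu _ _ (v0 x hx) h
      obtain ⟨q, hq, e⟩ := intermediate_value_Icc hxe vc ⟨hi.1.le, hi.2.le⟩
      exact ⟨i, q, hq, e⟩
    · obtain ⟨i, hi⟩ := hu _ _ (v0 (x+ε/2) (by linarith)) h
      obtain ⟨q, hq, e⟩ := intermediate_value_Icc' hxe vc ⟨hi.1.le, hi.2.le⟩
      exact ⟨i, q, hq, e⟩
  have hq1 : 1 < q := lt_of_lt_of_le hx hq.1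
  refine ⟨q, ⟨hq1, ?_⟩, ?_⟩
  swap
  · rw [Real.dist_eq, abs_sub_comm, abs_of_nonneg (by linarith [hq.1])]
    linarith [hq.2]
  intro hdiff
  obtain ⟨m, n, hmn, hmin⟩ := hk i
  obtain ⟨d, hd, hpos⟩ := third_deriv hq1
  have hfu : tauP (1/3) q = u i * (1 - q) := by
    rw [← hqi]; simp only [hv]
    rw [div_mul_cancel₀ _ (by linarith)]
  have gen : ∀ m, (∀ k, a m + b m * u i ≤ a k + b k * u i) →
      deriv (tauLq p) q = (a m * (-1) + b m * d) / 2 := by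
    intro m hm
    have hFd : HasDerivAt (fun q => (a m * (1-q) + b m * tauP (1/3) q) / 2)
        ((a m * (-1) + b m * d) / 2) q := by
      have h1 : HasDerivAt (fun q : ℝ => 1 - q) (-1) q := by
        simpa using (hasDerivAt_id q).const_sub 1
      exact ((h1.const_mul _).add (hd.const_mul _)).div_const _
    have hsub := hdiff.hasDerivAt.sub hFd
    have hmx : ∀ k, a k * (1-q) + b k * tauP (1/3) q ≤ a m * (1-q) + b m * tauP (1/3) q := by
      intro k
      rw [hfu]
      nlinarith [hm k]
    have heq : tauLq p q = (a m * (1-q) + b m * tauP (1/3) q) / 2 :=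
      le_antisymm ((hp q hq1).2 m hmx) ((hp q hq1).1 m)
    have hloc : IsLocalMin (tauLq p - fun q => (a m * (1-q) + b m * tauP (1/3) q) / 2) q := by
      filter_upwards [lt_mem_nhds hq1] with y hy
      have := (hp y hy).1 m
      simp only [Pi.sub_apply]
      linarith
    have := hloc.hasDerivAt_eq_zero hsub
    linarith
  have g1 := gen m (fun k => (hmin k).1)
  have g2 := gen n (fun k => (hmin k).2)
  have g3 : a m + b m * u i = a n + b n * u i := le_antisymm (hmin n).1 (hmin m).2
  have g4 : (b m - b n) * (d + u i) = 0 := by linarith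
  rcases mul_eq_zero.1 g4 with h | h
  · exact hmn (by linarith)
  · rw [hfu] at hpos
    have : d = - u i := by linarith
    rw [this] at hpos
    nlinarith
end

section
/- There exists a sequence (p_n)_{n≥1} with p_n ∈ (0,1) such that the L^q-spectrum τ(q) = limsup_{n→∞} (1/n) ∑_{k=1}^n log₂(p_k^q + (1−p_k)^q) of the associated inhomogeneous Bernoulli product has infinitely many phase transitions in (1,∞); moreover, this infinite set of non-differentiability points of τ has an accumulation point in (1,∞). -/
open MeasureTheory Filter Set
open scoped Topology ENNReal NNReal Classical

lemma round_seq (g : ℕ → ℝ) (hg : ∀ n, |g n| ≤ 1/4)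
    (hd : ∀ n : ℕ, n * |g (n+1) - g n| ≤ 1/4) :
    ∃ e : ℕ → Bool, ∀ n : ℕ,
      |∑ k ∈ Finset.range n, (if e k then (1:ℝ) else 0) - n * (1/2 + g n)| ≤ 1 := by
  set X : ℕ → ℝ := fun n => n * (1/2 + g n) with hX
  have h01 : ∀ n, 0 ≤ X (n+1) - X n ∧ X (n+1) - X n ≤ 1 := by
    intro n
    have e1 : X (n+1) - X n = 1/2 + g (n+1) + n * (g (n+1) - g n) := by
      simp only [hX]; push_cast; ring
    have h1 := abs_le.1 (hg (n+1))
    have h2 : |(n:ℝ) * (g (n+1) - g n)| ≤ 1/4 := by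
      rw [abs_mul, Nat.abs_cast]; exact hd n
    have h3 := abs_le.1 h2
    rw [e1]; constructor <;> linarith [h1.1, h1.2, h3.1, h3.2]
  have hs : ∀ n, ⌊X (n+1)⌋ = ⌊X n⌋ ∨ ⌊X (n+1)⌋ = ⌊X n⌋ + 1 := by
    intro n
    have a := h01 n
    have b1 : ⌊X n⌋ ≤ ⌊X (n+1)⌋ := Int.floor_mono (by linarith [a.1])
    have b2 : ⌊X (n+1)⌋ ≤ ⌊X n + 1⌋ := Int.floor_mono (by linarith [a.2])
    rw [Int.floor_add_one] at b2
    omega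
  refine ⟨fun k => decide (⌊X (k+1)⌋ = ⌊X k⌋ + 1), fun n => ?_⟩
  have hsum : ∑ k ∈ Finset.range n,
      (if (decide (⌊X (k+1)⌋ = ⌊X k⌋ + 1) : Bool) = true then (1:ℝ) else 0) = (⌊X n⌋ : ℝ) := by
    induction n with
    | zero => simp [hX]
    | succ n ih =>
      rw [Finset.sum_range_succ, ih]
      rcases hs n with h | h
      · simp [h]
      · simp [h]
  rw [hsum]
  have := Int.floor_le (X n)
  have := Int.lt_floor_add_one (X n)
  rw [abs_le]; simp only [hX] at *; constructor <;> linarith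

lemma log_step (n : ℕ) : n * |Real.log ((n+1 : ℕ) : ℝ) - Real.log n| ≤ 1 := by
  rcases Nat.eq_zero_or_pos n with rfl | hn
  · simp
  have hn' : (0:ℝ) < n := by exact_mod_cast hn
  push_cast
  rw [← Real.log_div (by positivity) (by positivity)]
  have h1 : (1:ℝ) ≤ (n+1)/n := by rw [le_div_iff₀ hn']; linarith
  rw [abs_of_nonneg (Real.log_nonneg h1)]
  have h2 := Real.log_le_sub_one_of_pos (show (0:ℝ) < (n+1)/n by positivity)
  calc (n:ℝ) * Real.log ((n+1)/n) ≤ n * ((n+1)/n - 1) := by gcongr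
    _ = 1 := by field_simp; ring

noncomputable def wS (K : ℝ) (n : ℕ) : ℝ := K * Real.sin (Real.log n)

lemma wS_abs {K : ℝ} (hK : 0 ≤ K) (n : ℕ) : |wS K n| ≤ K := by
  unfold wS
  rw [abs_mul, abs_of_nonneg hK]
  exact mul_le_of_le_one_right hK (Real.abs_sin_le_one _)

lemma wS_step {K : ℝ} (hK : 0 ≤ K) (n : ℕ) : n * |wS K (n+1) - wS K n| ≤ K := by
  unfold wS
  rw [← mul_sub, abs_mul, abs_of_nonneg hK]
  have h : |Real.sin (Real.log ((n+1:ℕ):ℝ)) - Real.sin (Real.log n)|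
      ≤ |Real.log ((n+1 : ℕ) : ℝ) - Real.log n| := by
    have := Real.lipschitzWith_sin.dist_le_mul (Real.log ((n+1:ℕ):ℝ)) (Real.log n)
    simpa [Real.dist_eq] using this
  have h2 := log_step n
  calc (n:ℝ) * (K * |Real.sin (Real.log ((n+1:ℕ):ℝ)) - Real.sin (Real.log n)|)
      ≤ n * (K * |Real.log ((n+1 : ℕ) : ℝ) - Real.log n|) := by gcongr
    _ = K * (n * |Real.log ((n+1 : ℕ) : ℝ) - Real.log n|) := by ring
    _ ≤ K * 1 := by gcongr
    _ = K := mul_one K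

lemma wS_cluster {K : ℝ} (hK : 0 < K) {w : ℝ} (hw : |w| ≤ K) :
    ∃ N : ℕ → ℕ, Tendsto N atTop atTop ∧ Tendsto (fun m => wS K (N m)) atTop (𝓝 w) := by
  set s := Real.arcsin (w / K) with hs
  have hsin : K * Real.sin s = w := by
    rw [abs_le] at hw
    rw [hs, Real.sin_arcsin]
    · field_simp
    · rw [le_div_iff₀ hK]; linarith
    · rw [div_le_iff₀ hK]; linarith
  set y : ℕ → ℝ := fun m => Real.exp (s + m * (2 * Real.pi)) with hy
  have hyt : Tendsto y atTop atTop := by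
    apply Real.tendsto_exp_atTop.comp
    apply tendsto_atTop_add_const_left
    exact tendsto_natCast_atTop_atTop.atTop_mul_const (by positivity)
  refine ⟨fun m => ⌊y m⌋₊, tendsto_nat_floor_atTop.comp hyt, ?_⟩
  have h1 : Tendsto (fun m => ((⌊y m⌋₊ : ℕ) : ℝ) / y m) atTop (𝓝 1) :=
    (tendsto_nat_floor_div_atTop (R := ℝ)).comp hyt
  have h2 : Tendsto (fun m => Real.log (((⌊y m⌋₊ : ℕ) : ℝ) / y m)) atTop (𝓝 0) := by
    have := (Real.continuousAt_log (one_ne_zero)).tendsto.comp h1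
    simpa [Function.comp_def] using this
  have h3 : Tendsto (fun m => K * Real.sin (s + Real.log (((⌊y m⌋₊ : ℕ) : ℝ) / y m))) atTop
      (𝓝 w) := by
    have hc : Continuous fun z => K * Real.sin (s + z) := by fun_prop
    have := (hc.tendsto 0).comp h2
    simpa [Function.comp_def, hsin] using this
  refine h3.congr' ?_
  filter_upwards [hyt.eventually_ge_atTop 1] with m hm
  have hpos : 0 < ⌊y m⌋₊ := Nat.floor_pos.2 hm
  have hp : (0:ℝ) < ((⌊y m⌋₊ : ℕ) : ℝ) := by exact_mod_cast hpos
  unfold wS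
  rw [Real.log_div hp.ne' (by positivity)]
  have : Real.log (y m) = s + m * (2 * Real.pi) := by simp [hy]
  rw [this, ← Real.sin_sub_nat_mul_two_pi (Real.log _) m]
  congr 2
  ring

noncomputable def psiS (T : Set ℝ) (w : ℝ) : ℝ := ((Metric.infDist w T)^2 - w^2) / 2

lemma psiS_cont (T : Set ℝ) : Continuous (psiS T) := by
  unfold psiS
  have := Metric.continuous_infDist_pt T
  fun_prop

lemma infD_le {T : Set ℝ} {K : ℝ} (hT : ∀ t ∈ T, |t| ≤ K) (hne : T.Nonempty) {w : ℝ}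
    (hw : |w| ≤ K) : Metric.infDist w T ≤ 2 * K := by
  obtain ⟨t, ht⟩ := hne
  refine (Metric.infDist_le_dist_of_mem ht).trans ?_
  rw [Real.dist_eq]
  have := abs_le.1 hw
  have := abs_le.1 (hT t ht)
  rw [abs_le]; constructor <;> linarith

lemma psiS_abs {T : Set ℝ} {K : ℝ} (hT : ∀ t ∈ T, |t| ≤ K) (hne : T.Nonempty) {w : ℝ}
    (hw : |w| ≤ K) : |psiS T w| ≤ 3 * K^2 := by
  have h1 := infD_le hT hne hw
  have h0 : 0 ≤ Metric.infDist w T := Metric.infDist_nonneg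
  have h2 : w^2 ≤ K^2 := by rw [← sq_abs w]; gcongr
  have h3 : (Metric.infDist w T)^2 ≤ (2*K)^2 := by gcongr
  unfold psiS
  rw [abs_le]; constructor <;> nlinarith [sq_nonneg w, sq_nonneg (Metric.infDist w T), sq_nonneg K]

lemma psiS_lip {T : Set ℝ} {K : ℝ} (hT : ∀ t ∈ T, |t| ≤ K) (hne : T.Nonempty) {w z : ℝ}
    (hw : |w| ≤ K) (hz : |z| ≤ K) : |psiS T w - psiS T z| ≤ 3 * K * |w - z| := by
  have h1 := infD_le hT hne hw
  have h2 := infD_le hT hne hz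
  have h0 : 0 ≤ Metric.infDist w T := Metric.infDist_nonneg
  have h0' : 0 ≤ Metric.infDist z T := Metric.infDist_nonneg
  have h3 : |Metric.infDist w T - Metric.infDist z T| ≤ |w - z| := by
    have := (Metric.lipschitz_infDist_pt T).dist_le_mul w z
    simpa [Real.dist_eq] using this
  have hK : 0 ≤ K := (abs_nonneg _).trans hw
  have e : psiS T w - psiS T z = (Metric.infDist w T - Metric.infDist z T) *
      ((Metric.infDist w T + Metric.infDist z T)/2) - (w - z) * ((w+z)/2) := by
    unfold psiS; ring
  rw [e]
  refine (abs_sub _ _).trans ?_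
  rw [abs_mul, abs_mul]
  have h4 : |(Metric.infDist w T + Metric.infDist z T)/2| ≤ 2 * K := by
    rw [abs_le]; constructor <;> linarith
  have h5 : |(w+z)/2| ≤ K := by
    have := abs_le.1 hw
    have := abs_le.1 hz
    rw [abs_le]; constructor <;> linarith
  have h6 := mul_le_mul h3 h4 (abs_nonneg _) (abs_nonneg _)
  have h7 := mul_le_mul_of_nonneg_left h5 (abs_nonneg (w - z))
  linarith

/-- Existence of a sequence with the prescribed asymptotic averages. -/
lemma exists_seq {a b : ℝ} (ha : a ∈ Set.Ioo (0:ℝ) 1) (hb : b ∈ Set.Ioo (0:ℝ) 1)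
    (g h : ℕ → ℝ) (hg : ∀ n, |g n| ≤ 1/4)
    (hgd : ∀ n : ℕ, n * |g (n+1) - g n| ≤ 1/4) (hh : ∀ n, |h n| ≤ 1/4)
    (hhd : ∀ n : ℕ, n * |h (n+1) - h n| ≤ 1/4) :
    ∃ p : ℕ → ℝ, (∀ k, p k ∈ Set.Ioo (0:ℝ) 1) ∧ ∀ q : ℝ,
      Tendsto (fun N => tauN p N q - (tauP (1/2) q + ((1/2 + g (N/2)) * (tauP a q - tauP (1/2) q)
        + (1/2 + h (N/2)) * (tauP b q - tauP (1/2) q)) / 2)) atTop (𝓝 0) := by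
  obtain ⟨e, he⟩ := round_seq g hg hgd
  obtain ⟨d, hd⟩ := round_seq h hh hhd
  set p : ℕ → ℝ := fun k => if k % 2 = 0 then (if e (k/2) then a else 1/2)
    else (if d (k/2) then b else 1/2) with hp
  refine ⟨p, ?_, ?_⟩
  · intro k
    have hc : (1/2:ℝ) ∈ Set.Ioo (0:ℝ) 1 := by constructor <;> norm_num
    simp only [hp]
    split_ifs <;> assumption
  intro q
  set C := tauP (1/2) q with hC
  set u := tauP a q - C with hu
  set v := tauP b q - C with hv
  set M := |C| + |u| + |v| with hM
  have hpe : ∀ n, tauP (p (2*n)) q = C + u * (if e n then (1:ℝ) else 0) := by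
    intro n
    have h1 : (2*n)/2 = n := by omega
    simp only [hp, Nat.mul_mod_right, h1, if_true]
    split_ifs <;> simp [hu, hC]
  have hpo : ∀ n, tauP (p (2*n+1)) q = C + v * (if d n then (1:ℝ) else 0) := by
    intro n
    have h1 : (2*n+1)/2 = n := by omega
    have h2 : ¬ ((2*n+1) % 2 = 0) := by omega
    simp only [hp, h1, if_neg h2]
    split_ifs <;> simp [hv, hC]
  have hev : ∀ n, ∑ k ∈ Finset.range (2*n), tauP (p k) q = 2 * n * C
      + u * ∑ k ∈ Finset.range n, (if e k then (1:ℝ) else 0)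
      + v * ∑ k ∈ Finset.range n, (if d k then (1:ℝ) else 0) := by
    intro n
    induction n with
    | zero => simp
    | succ n ih =>
      rw [show 2 * (n+1) = 2*n+1+1 by ring, Finset.sum_range_succ, Finset.sum_range_succ, ih,
        Finset.sum_range_succ, Finset.sum_range_succ, hpe, hpo]
      push_cast; ring
  set Φ : ℕ → ℝ := fun n => C + ((1/2 + g n) * u + (1/2 + h n) * v)/2 with hΦ
  have hΦb : ∀ n, |Φ n| ≤ M := by
    intro n
    have a1 : |(1/2 + g n) * u| ≤ |u| := by
      rw [abs_mul]
      apply mul_le_of_le_one_left (abs_nonneg _)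
      have := abs_le.1 (hg n)
      rw [abs_le]; constructor <;> linarith
    have a2 : |(1/2 + h n) * v| ≤ |v| := by
      rw [abs_mul]
      apply mul_le_of_le_one_left (abs_nonneg _)
      have := abs_le.1 (hh n)
      rw [abs_le]; constructor <;> linarith
    have := abs_le.1 a1
    have := abs_le.1 a2
    have := abs_nonneg u
    have := abs_nonneg v
    have := neg_abs_le C
    have := le_abs_self C
    simp only [hΦ, hM]
    rw [abs_le]; constructor <;> linarith
  have hevb : ∀ n : ℕ, |∑ k ∈ Finset.range (2*n), tauP (p k) q - 2 * n * Φ n| ≤ M := by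
    intro n
    have e1 : ∑ k ∈ Finset.range (2*n), tauP (p k) q - 2 * n * Φ n =
      u * (∑ k ∈ Finset.range n, (if e k then (1:ℝ) else 0) - n * (1/2 + g n)) +
      v * (∑ k ∈ Finset.range n, (if d k then (1:ℝ) else 0) - n * (1/2 + h n)) := by
      rw [hev]; simp only [hΦ]; ring
    rw [e1]
    refine (abs_add_le _ _).trans ?_
    rw [abs_mul, abs_mul]
    have := mul_le_of_le_one_right (abs_nonneg u) (he n)
    have := mul_le_of_le_one_right (abs_nonneg v) (hd n)
    have := abs_nonneg C
    simp only [hM]; linarith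
  have hoddt : ∀ n, |tauP (p (2*n)) q| ≤ M := by
    intro n
    rw [hpe]
    refine (abs_add_le _ _).trans ?_
    have := abs_nonneg u
    have := abs_nonneg v
    split_ifs <;> simp [hM]
    linarith
  have hall : ∀ N : ℕ, |∑ k ∈ Finset.range N, tauP (p k) q - N * Φ (N/2)| ≤ 3 * M := by
    intro N
    have hM0 : 0 ≤ M := by positivity
    rcases Nat.even_or_odd' N with ⟨n, rfl | rfl⟩
    · have h1 : (2*n)/2 = n := by omega
      rw [h1]; push_cast
      linarith [hevb n]
    · have h1 : (2*n+1)/2 = n := by omega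
      rw [h1, Finset.sum_range_succ]; push_cast
      have b1 := abs_le.1 (hevb n)
      have b2 := abs_le.1 (hoddt n)
      have b3 := abs_le.1 (hΦb n)
      rw [abs_le]; constructor <;> nlinarith
  rw [tendsto_zero_iff_abs_tendsto_zero]
  refine squeeze_zero' (g := fun N : ℕ => 3 * M / N) (Eventually.of_forall fun _ => abs_nonneg _) ?_
    (tendsto_const_div_atTop_nhds_zero_nat _)
  filter_upwards [eventually_gt_atTop 0] with N hN
  have hN' : (0:ℝ) < N := by exact_mod_cast hN
  have e2 : tauN p N q - Φ (N/2) = (∑ k ∈ Finset.range N, tauP (p k) q - N * Φ (N/2)) / N := by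
    unfold tauN; field_simp
  change |tauN p N q - Φ (N/2)| ≤ _
  rw [e2, abs_div, Nat.abs_cast]
  gcongr
  exact hall N

lemma tauP_contDiff {p : ℝ} (hp : p ∈ Set.Ioo (0:ℝ) 1) : ContDiff ℝ 1 (tauP p) := by
  have h1 : 0 < p := hp.1
  have h2 : 0 < 1 - p := by linarith [hp.2]
  unfold tauP Real.logb
  refine ContDiff.div_const (ContDiff.log ?_ ?_) _
  · exact (contDiff_const.rpow contDiff_id fun _ => h1.ne').add
      (contDiff_const.rpow contDiff_id fun _ => h2.ne')
  · intro x; positivity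

/-- Limit of a sequence asymptotic to another. -/
lemma limsup_ub {f Φ : ℕ → ℝ} (hf : Tendsto (fun N => f N - Φ N) atTop (𝓝 0)) {B V : ℝ}
    (hB : ∀ n, |Φ n| ≤ B) (hV : ∀ n, Φ n ≤ V) : limsup f atTop ≤ V := by
  apply le_of_forall_pos_le_add
  intro ε hε
  have hco : IsCoboundedUnder (· ≤ ·) atTop f := by
    apply IsBoundedUnder.isCoboundedUnder_le
    refine ⟨-B - ε, ?_⟩
    simp only [eventually_map]
    filter_upwards [(tendsto_order.1 hf).1 (-ε) (by linarith)] with n hn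
    have := abs_le.1 (hB n)
    show -B - ε ≤ f n
    linarith
  refine limsup_le_of_le hco ?_
  filter_upwards [(tendsto_order.1 hf).2 ε hε] with n hn
  linarith [hV n]

lemma limsup_lb {f Φ : ℕ → ℝ} (hf : Tendsto (fun N => f N - Φ N) atTop (𝓝 0)) {B V : ℝ}
    (hB : ∀ n, |Φ n| ≤ B) {N : ℕ → ℕ} (hN : Tendsto N atTop atTop)
    (hV : Tendsto (fun m => Φ (N m)) atTop (𝓝 V)) : V ≤ limsup f atTop := by
  apply le_of_forall_pos_le_add
  intro ε hε
  have hbd : IsBoundedUnder (· ≤ ·) atTop f := by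
    refine ⟨B + 1, ?_⟩
    simp only [eventually_map]
    filter_upwards [(tendsto_order.1 hf).2 1 one_pos] with n hn
    have := abs_le.1 (hB n)
    linarith
  have h1 : Tendsto (fun m => f (N m)) atTop (𝓝 V) := by
    have := (hf.comp hN).add hV
    simpa using this
  have h2 : ∃ᶠ n in atTop, V - ε ≤ f n := by
    refine hN.frequently (p := fun n => V - ε ≤ f n) (Eventually.frequently ?_)
    exact (h1.eventually (lt_mem_nhds (by linarith : V - ε < V))).mono fun _ h => h.le
  have := le_limsup_of_frequently_le h2 hbd
  linarith

noncomputable def uF (q : ℝ) : ℝ := tauP (1/3) q - tauP (1/2) q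
noncomputable def vF (q : ℝ) : ℝ := tauP (1/4) q - tauP (1/2) q

lemma uF_cd : ContDiff ℝ 1 uF :=
  (tauP_contDiff (by constructor <;> norm_num)).sub (tauP_contDiff (by constructor <;> norm_num))

lemma vF_cd : ContDiff ℝ 1 vF :=
  (tauP_contDiff (by constructor <;> norm_num)).sub (tauP_contDiff (by constructor <;> norm_num))

lemma vF_pos {q : ℝ} (hq : 2 ≤ q) : 0 < vF q := by
  unfold vF tauP
  rw [sub_pos]
  apply Real.logb_lt_logb (by norm_num) (by positivity)
  have h1 : (1 - 1/4 : ℝ)^q = (1/2:ℝ)^q * (3/2:ℝ)^q := by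
    rw [← Real.mul_rpow (by norm_num) (by norm_num)]; norm_num
  have h2 : (3/2:ℝ)^(2:ℝ) ≤ (3/2:ℝ)^q := Real.rpow_le_rpow_of_exponent_le (by norm_num) hq
  have h3 : (3/2:ℝ)^(2:ℝ) = 9/4 := by
    rw [show (2:ℝ) = ((2:ℕ):ℝ) by norm_num, Real.rpow_natCast]; norm_num
  have h4 : (0:ℝ) < (1/2:ℝ)^q := by positivity
  have h5 : (0:ℝ) < (1/4:ℝ)^q := by positivity
  rw [h1, show (1 - 1/2 : ℝ) = 1/2 by norm_num]
  nlinarith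

lemma r_two : 2 * uF 2 < vF 2 := by
  unfold uF vF tauP
  rw [show (2:ℝ) = ((2:ℕ):ℝ) by norm_num]
  simp only [Real.rpow_natCast]
  norm_num
  rw [show Real.logb 2 (1/2) = -1 by
    rw [one_div, Real.logb_inv, Real.logb_self_eq_one (by norm_num)]]
  have h : Real.logb 2 ((5/9)^2 * 2) < Real.logb 2 (5/8) :=
    Real.logb_lt_logb (by norm_num) (by norm_num) (by norm_num)
  rw [Real.logb_mul (by norm_num) (by norm_num), Real.logb_pow,
    Real.logb_self_eq_one (by norm_num)] at h
  push_cast at h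
  linarith

lemma r_three : vF 3 < 2 * uF 3 := by
  unfold uF vF tauP
  rw [show (3:ℝ) = ((3:ℕ):ℝ) by norm_num]
  simp only [Real.rpow_natCast]
  norm_num
  rw [show Real.logb 2 (1/4) = -2 by
    rw [one_div, Real.logb_inv, show (4:ℝ) = 2^2 by norm_num, Real.logb_pow,
      Real.logb_self_eq_one (by norm_num)]; norm_num]
  have h : Real.logb 2 (7/16) < Real.logb 2 ((1/3)^2 * 2^2) :=
    Real.logb_lt_logb (by norm_num) (by norm_num) (by norm_num)
  rw [Real.logb_mul (by norm_num) (by norm_num), Real.logb_pow, Real.logb_pow,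
    Real.logb_self_eq_one (by norm_num)] at h
  push_cast at h
  linarith

noncomputable def rF (q : ℝ) : ℝ := uF q / vF q

lemma exists_interval : ∃ q₀ δ : ℝ, 2 < q₀ ∧ 0 < δ ∧
    StrictMonoOn rF (Set.Ico q₀ (q₀ + δ)) ∧
    ∀ q ∈ Set.Ico q₀ (q₀ + δ), 0 < deriv rF q := by
  have hcdv : ∀ q : ℝ, 2 ≤ q → ContDiffAt ℝ 1 rF q := fun q hq =>
    uF_cd.contDiffAt.div vF_cd.contDiffAt (vF_pos hq).ne'
  have hc : ContinuousOn rF (Set.Icc 2 3) := fun q hq =>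
    (hcdv q hq.1).continuousAt.continuousWithinAt
  obtain ⟨q₀, hq₀, hd⟩ := exists_deriv_eq_slope rF (by norm_num : (2:ℝ) < 3) hc
    (fun q hq => ((hcdv q hq.1.le).differentiableAt (by norm_num)).differentiableWithinAt)
  have hpos : 0 < deriv rF q₀ := by
    rw [hd]
    have h2 : rF 2 < 1/2 := by
      unfold rF; rw [div_lt_iff₀ (vF_pos le_rfl)]; linarith [r_two]
    have h3 : 1/2 < rF 3 := by
      unfold rF; rw [lt_div_iff₀ (vF_pos (by norm_num))]; linarith [r_three]
    apply div_pos <;> linarith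
  have hcon : ContDiffOn ℝ 1 rF (Set.Ioo 2 3) := fun q hq => (hcdv q hq.1.le).contDiffWithinAt
  have hdc := hcon.continuousOn_deriv_of_isOpen isOpen_Ioo (by norm_num)
  have hdc0 : ContinuousAt (deriv rF) q₀ := hdc.continuousAt (isOpen_Ioo.mem_nhds hq₀)
  have hev : ∀ᶠ q in 𝓝 q₀, 0 < deriv rF q := hdc0.eventually (lt_mem_nhds hpos)
  obtain ⟨δ, hδ, hball⟩ := Metric.eventually_nhds_iff.1 hev
  have hall : ∀ q ∈ Set.Ico q₀ (q₀ + δ), 0 < deriv rF q := by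
    intro q hq
    apply hball
    rw [Real.dist_eq, abs_lt]; constructor <;> linarith [hq.1, hq.2]
  refine ⟨q₀, δ, hq₀.1, hδ, ?_, hall⟩
  apply strictMonoOn_of_deriv_pos (convex_Ico _ _)
  · intro q hq
    exact (hcdv q (by linarith [hq.1, hq₀.1])).continuousAt.continuousWithinAt
  · intro q hq
    exact hall q (interior_subset hq)

/-- **Theorem 4.6.** There exists an inhomogeneous Bernoulli product whose `L^q`-spectrum
has infinitely many phase transitions in `(1, ∞)`, and this set of non-differentiability
points has a finite accumulation point in `(1, ∞)`. -/
theorem stmt4 :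
    ∃ p : ℕ → ℝ, (∀ k, p k ∈ Set.Ioo (0:ℝ) 1) ∧
      {q : ℝ | q ∈ Set.Ioi (1:ℝ) ∧ ¬ DifferentiableAt ℝ (tauLq p) q}.Infinite ∧
      ∃ q₀ ∈ Set.Ioi (1:ℝ),
        AccPt q₀ (Filter.principal
          {q : ℝ | q ∈ Set.Ioi (1:ℝ) ∧ ¬ DifferentiableAt ℝ (tauLq p) q}) := by

  obtain ⟨q₀, δ, hq₀, hδ, hmono, hder⟩ := exists_interval
  set Q : ℕ → ℝ := fun k => q₀ + δ / (k + 2) with hQ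
  have hQmem : ∀ k, Q k ∈ Set.Ioo q₀ (q₀ + δ) := by
    intro k
    have h1 : 0 < δ / ((k:ℝ) + 2) := by positivity
    have h2 : δ / ((k:ℝ) + 2) < δ := div_lt_self hδ (by linarith [Nat.cast_nonneg (α := ℝ) k])
    simp only [hQ]
    constructor <;> linarith
  have hQmem' : ∀ k, Q k ∈ Set.Ico q₀ (q₀ + δ) := fun k => Set.Ioo_subset_Ico_self (hQmem k)
  have hQanti : StrictAnti Q := by
    intro i j hij
    have : (i:ℝ) < j := by exact_mod_cast hij
    simp only [hQ]
    gcongr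
  have hQlim : Tendsto Q atTop (𝓝 q₀) := by
    have h1 : Tendsto (fun k : ℕ => δ / ((k:ℝ) + 2)) atTop (𝓝 0) :=
      tendsto_const_nhds.div_atTop (tendsto_atTop_add_const_right _ _ tendsto_natCast_atTop_atTop)
    simpa [hQ] using h1.const_add q₀
  set t : ℕ → ℝ := fun k => rF (Q k) with ht
  have htanti : StrictAnti t := fun i j hij => hmono (hQmem' j) (hQmem' i) (hQanti hij)
  set T : Set ℝ := Set.range t with hT
  have hTne : T.Nonempty := ⟨t 0, 0, rfl⟩
  set K : ℝ := |rF q₀| + |t 0| + 1 with hK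
  have hK1 : 1 ≤ K := by
    have := abs_nonneg (rF q₀)
    have := abs_nonneg (t 0)
    simp only [hK]; linarith
  have hK0 : 0 < K := by linarith
  have htK : ∀ k, |t k| ≤ K := by
    intro k
    have h1 : rF q₀ < t k := hmono ⟨le_rfl, by linarith⟩ (hQmem' k) (hQmem k).1
    have h2 : t k ≤ t 0 := htanti.antitone (Nat.zero_le k)
    have := neg_abs_le (rF q₀)
    have := le_abs_self (t 0)
    have := abs_nonneg (rF q₀)
    have := abs_nonneg (t 0)
    rw [abs_le]; simp only [hK]; constructor <;> linarith
  have hTK : ∀ x ∈ T, |x| ≤ K := by rintro _ ⟨k, rfl⟩; exact htK k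
  set η : ℝ := 1 / (12 * K^2) with hη
  have hη0 : 0 < η := by positivity
  have hηK : η * (3 * K^2) = 1/4 := by simp only [hη]; field_simp; norm_num
  have hKK : K ≤ 3 * K^2 := by nlinarith
  obtain ⟨p, hp, hlim⟩ := exists_seq (a := 1/3) (b := 1/4) (by constructor <;> norm_num)
    (by constructor <;> norm_num)
    (fun n => η * wS K n) (fun n => η * psiS T (wS K n))
    (by
      intro n
      rw [abs_mul, abs_of_pos hη0, ← hηK]
      gcongr
      exact (wS_abs hK0.le n).trans hKK)
    (by
      intro n
      rw [← mul_sub, abs_mul, abs_of_pos hη0, ← hηK]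
      have := wS_step hK0.le n
      calc (n:ℝ) * (η * |wS K (n+1) - wS K n|) = η * (n * |wS K (n+1) - wS K n|) := by ring
        _ ≤ η * (3 * K^2) := mul_le_mul_of_nonneg_left (by linarith) hη0.le)
    (by
      intro n
      rw [abs_mul, abs_of_pos hη0, ← hηK]
      gcongr
      exact psiS_abs hTK hTne (wS_abs hK0.le n))
    (by
      intro n
      rw [← mul_sub, abs_mul, abs_of_pos hη0, ← hηK]
      have h1 := wS_step hK0.le n
      have h2 := psiS_lip hTK hTne (wS_abs hK0.le (n+1)) (wS_abs hK0.le n)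
      calc (n:ℝ) * (η * |psiS T (wS K (n+1)) - psiS T (wS K n)|)
          ≤ n * (η * (3 * K * |wS K (n+1) - wS K n|)) := by gcongr
        _ = η * (3 * K * (n * |wS K (n+1) - wS K n|)) := by ring
        _ ≤ η * (3 * K * K) := by gcongr
        _ = η * (3 * K^2) := by ring)
  set F : ℝ → ℝ → ℝ := fun w q => tauP (1/2) q + ((1/2 + η * w) * uF q
    + (1/2 + η * psiS T w) * vF q) / 2 with hF
  have hlim' : ∀ q, Tendsto (fun N => tauN p N q - F (wS K (N/2)) q) atTop (𝓝 0) := hlim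
  have hFc : ∀ q, Continuous fun w => F w q := by
    intro q
    have := psiS_cont T
    simp only [hF]; fun_prop
  have hFb : ∀ q, ∃ B, ∀ N : ℕ, |F (wS K (N/2)) q| ≤ B := by
    intro q
    obtain ⟨B, hB⟩ := (isCompact_Icc (a := -K) (b := K)).exists_bound_of_continuousOn
      (hFc q).continuousOn
    exact ⟨B, fun N => hB _ (abs_le.1 (wS_abs hK0.le _))⟩
  -- lower bound
  have hlow : ∀ q w, |w| ≤ K → F w q ≤ tauLq p q := by
    intro q w hw
    obtain ⟨B, hB⟩ := hFb q
    obtain ⟨N, hN, hNw⟩ := wS_cluster hK0 hw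
    refine limsup_lb (hlim' q) hB (N := fun m => 2 * N m) (hN.const_mul_atTop' two_pos) ?_
    have h1 : ∀ m, 2 * N m / 2 = N m := fun m => by omega
    simp only [h1]
    exact ((hFc q).tendsto w).comp hNw
  -- upper bound
  have hup : ∀ k, tauLq p (Q k) ≤ tauP (1/2) (Q k) + (uF (Q k) + vF (Q k)) / 4
      + η / 2 * vF (Q k) * ((t k)^2 / 2) := by
    intro k
    obtain ⟨B, hB⟩ := hFb (Q k)
    refine limsup_ub (hlim' (Q k)) hB ?_
    intro n
    generalize wS K (n/2) = w
    have hv : 0 < vF (Q k) := vF_pos (by linarith [(hQmem k).1])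
    have hu : uF (Q k) = t k * vF (Q k) := by simp only [ht, rF]; field_simp
    have hd : Metric.infDist w T ≤ |w - t k| := by
      have := Metric.infDist_le_dist_of_mem (x := w) (show t k ∈ T from ⟨k, rfl⟩)
      rwa [Real.dist_eq] at this
    have hd2 : (Metric.infDist w T)^2 ≤ (w - t k)^2 := by
      rw [← sq_abs (w - t k)]
      have := Metric.infDist_nonneg (x := w) (s := T)
      gcongr
    have hkey : w * t k + psiS T w ≤ (t k)^2/2 := by
      unfold psiS; nlinarith
    have : η / 2 * vF (Q k) * (w * t k + psiS T w) ≤ η / 2 * vF (Q k) * ((t k)^2 / 2) := by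
      gcongr
    simp only [hF]
    rw [hu]
    linarith
  have heq : ∀ k w, Metric.infDist w T = |w - t k| → F w (Q k) =
      tauP (1/2) (Q k) + (uF (Q k) + vF (Q k)) / 4 + η / 2 * vF (Q k) * ((t k)^2 / 2) := by
    intro k w hw
    have hv : 0 < vF (Q k) := vF_pos (by linarith [(hQmem k).1])
    have hu : uF (Q k) = t k * vF (Q k) := by simp only [ht, rF]; field_simp
    simp only [hF, psiS]
    rw [hw, sq_abs, hu]
    ring
  have hFd : ∀ w q, HasDerivAt (F w) (deriv (tauP (1/2)) q + ((1/2 + η * w) * deriv uF q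
    + (1/2 + η * psiS T w) * deriv vF q) / 2) q := by
    intro w q
    have h0 : HasDerivAt (tauP (1/2)) (deriv (tauP (1/2)) q) q :=
      (((tauP_contDiff (by constructor <;> norm_num)).differentiable (by norm_num)) q).hasDerivAt
    have h1 : HasDerivAt uF (deriv uF q) q := ((uF_cd.differentiable (by norm_num)) q).hasDerivAt
    have h2 : HasDerivAt vF (deriv vF q) q := ((vF_cd.differentiable (by norm_num)) q).hasDerivAt
    exact h0.add (((h1.const_mul _).add (h2.const_mul _)).div_const 2)
  have htouch : ∀ k w, |w| ≤ K → Metric.infDist w T = |w - t k| →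
      DifferentiableAt ℝ (tauLq p) (Q k) →
      deriv (tauLq p) (Q k) = deriv (tauP (1/2)) (Q k) + ((1/2 + η * w) * deriv uF (Q k)
    + (1/2 + η * psiS T w) * deriv vF (Q k)) / 2 := by
    intro k w hw hwd hdiff
    have hmin : IsLocalMin (fun q => tauLq p q - F w q) (Q k) := by
      refine Eventually.of_forall fun q => ?_
      have h1 := hlow q w hw
      have h2 := hup k
      have h3 := heq k w hwd
      show tauLq p (Q k) - F w (Q k) ≤ tauLq p q - F w q
      linarith
    have := hmin.hasDerivAt_eq_zero (hdiff.hasDerivAt.sub (hFd w (Q k)))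
    linarith
  have hnd : ∀ k, ¬ DifferentiableAt ℝ (tauLq p) (Q k) := by
    intro k hdiff
    have hlt : t (k+1) < t k := htanti (Nat.lt_succ_self k)
    set m := (t k + t (k+1)) / 2 with hm
    have d1 : Metric.infDist (t k) T = |t k - t k| := by
      rw [sub_self, abs_zero]; exact Metric.infDist_zero_of_mem ⟨k, rfl⟩
    have d2 : Metric.infDist m T = |m - t k| := by
      apply le_antisymm
      · have := Metric.infDist_le_dist_of_mem (x := m) (show t k ∈ T from ⟨k, rfl⟩)
        rwa [Real.dist_eq] at this
      · rw [Metric.le_infDist hTne]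
        rintro _ ⟨j, rfl⟩
        rw [Real.dist_eq, abs_of_nonpos (by linarith : m - t k ≤ 0)]
        rcases Nat.lt_or_ge k j with hj | hj
        · have := htanti.antitone (Nat.succ_le_of_lt hj)
          have : t j ≤ t (k+1) := this
          exact le_trans (by linarith) (le_abs_self _)
        · have := htanti.antitone hj
          exact le_trans (by linarith) (neg_le_abs _)
    have hmK : |m| ≤ K := by
      have := abs_le.1 (htK k)
      have := abs_le.1 (htK (k+1))
      rw [abs_le]; constructor <;> linarith
    have e1 := htouch k (t k) (htK k) d1 hdiff
    have e2 := htouch k m hmK d2 hdiff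
    have f1 := heq k (t k) d1
    have f2 := heq k m d2
    have f3 := f1.trans f2.symm
    have e3 := e1.symm.trans e2
    simp only [hF] at f3
    have hv : 0 < vF (Q k) := vF_pos (by linarith [(hQmem k).1])
    have g1 : (t k - m) * uF (Q k) + (psiS T (t k) - psiS T m) * vF (Q k) = 0 := by
      apply mul_left_cancel₀ hη0.ne'; linarith
    have g2 : (t k - m) * deriv uF (Q k) + (psiS T (t k) - psiS T m) * deriv vF (Q k) = 0 := by
      apply mul_left_cancel₀ hη0.ne'; linarith
    have g3 : (t k - m) * (deriv uF (Q k) * vF (Q k) - uF (Q k) * deriv vF (Q k)) = 0 := by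
      linear_combination vF (Q k) * g2 - deriv vF (Q k) * g1
    have hr : deriv rF (Q k) =
        (deriv uF (Q k) * vF (Q k) - uF (Q k) * deriv vF (Q k)) / (vF (Q k))^2 :=
      (((uF_cd.differentiable (by norm_num)) (Q k)).hasDerivAt.div
        ((vF_cd.differentiable (by norm_num)) (Q k)).hasDerivAt hv.ne').deriv
    have hrp := hder (Q k) (hQmem' k)
    rcases mul_eq_zero.1 g3 with h | h
    · linarith
    · rw [hr, h, zero_div] at hrp
      exact lt_irrefl _ hrp
  have hmemS : ∀ k, Q k ∈ {q : ℝ | q ∈ Set.Ioi (1:ℝ) ∧ ¬ DifferentiableAt ℝ (tauLq p) q} :=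
    fun k => ⟨by show (1:ℝ) < Q k; linarith [(hQmem k).1], hnd k⟩
  refine ⟨p, hp, ?_, q₀, by show (1:ℝ) < q₀; linarith, ?_⟩
  · exact (Set.infinite_range_of_injective hQanti.injective).mono
      (by rintro _ ⟨k, rfl⟩; exact hmemS k)
  · rw [accPt_iff_frequently]
    refine hQlim.frequently (Eventually.frequently (Eventually.of_forall fun k => ?_))
    exact ⟨(hQmem k).1.ne', hmemS k⟩
end

section
/- Let μ be an inhomogeneous Bernoulli product on Σ with weights (p_k) ⊂ (0,1), and let q ∈ ℝ be such that τ is finite on a neighborhood of q, with left and right derivatives τ'(q⁻) and τ'(q⁺) at q. Let ν be the inhomogeneous Bernoulli product with weights p̃_k = p_k^q/(p_k^q + (1−p_k)^q). Then ν( E̲_{−τ'(q⁻)} ∩ F̄_{−τ'(q⁺)} ) = 1, where the level sets are taken with respect to μ. -/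
open MeasureTheory Filter Set
open scoped Topology ENNReal NNReal Classical

lemma aux_Zpos {a : ℝ} (ha : a ∈ Set.Ioo (0:ℝ) 1) (q : ℝ) : 0 < a ^ q + (1 - a) ^ q := by
  have h1 := ha.1
  have h2 : 0 < 1 - a := by linarith [ha.2]
  positivity

lemma aux_tau (p : ℕ → ℝ) (hp : ∀ k, p k ∈ Set.Ioo (0:ℝ) 1) (q : ℝ) (n : ℕ) (hn : 0 < n) :
    ∏ k ∈ Finset.range n, (p k ^ q + (1 - p k) ^ q) = (2:ℝ) ^ ((n:ℝ) * tauN p n q) := by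
  have hn' : (n:ℝ) ≠ 0 := by positivity
  have : (n:ℝ) * tauN p n q = ∑ k ∈ Finset.range n, tauP (p k) q := by
    unfold tauN; field_simp
  rw [this, Real.rpow_sum_of_pos (by norm_num)]
  refine Finset.prod_congr rfl fun k _ => ?_
  rw [tauP, Real.rpow_logb (by norm_num) (by norm_num) (aux_Zpos (hp k) q)]

lemma aux_Ppos (p : ℕ → ℝ) (hp : ∀ k, p k ∈ Set.Ioo (0:ℝ) 1) (n : ℕ) (x : ℕ → Bool) :
    0 < ∏ j ∈ Finset.range n, if x j then 1 - p j else p j := by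
  refine Finset.prod_pos fun j _ => ?_
  have := hp j
  split_ifs
  · linarith [this.2]
  · exact this.1

lemma aux_cheb (p : ℕ → ℝ) (hp : ∀ k, p k ∈ Set.Ioo (0:ℝ) 1)
    (μ : Measure (ℕ → Bool)) (hμ : IsBernoulli μ p)
    (q : ℝ) (ν : Measure (ℕ → Bool))
    (hν : IsBernoulli ν (fun k => p k ^ q / (p k ^ q + (1 - p k) ^ q)))
    (t c : ℝ) (n : ℕ) (hn : 0 < n) :
    ν {x | t * alphaN μ x n ≤ c} ≤
      ENNReal.ofReal ((2:ℝ) ^ ((n:ℝ) * (tauN p n (q + t) - tauN p n q + c))) := by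
  set r : ℕ → ℝ := fun k => p k ^ q / (p k ^ q + (1 - p k) ^ q) with hr
  have hr01 : ∀ k, r k ∈ Set.Ioo (0:ℝ) 1 := by
    intro k
    have h1 := (hp k).1
    have h2 : 0 < 1 - p k := by linarith [(hp k).2]
    have h3 := aux_Zpos (hp k) q
    have h4 : 0 < (1 - p k) ^ q := by positivity
    refine ⟨by positivity, ?_⟩
    rw [hr]; simp only
    rw [div_lt_one h3]; linarith
  let ext : (Fin n → Bool) → (ℕ → Bool) := fun e i => if h : i < n then e ⟨i, h⟩ else false
  let S : Set (ℕ → Bool) := {x | t * alphaN μ x n ≤ c}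
  let P : (ℕ → Bool) → ℝ := fun x => ∏ j ∈ Finset.range n, if x j then 1 - p j else p j
  let Q : (ℕ → Bool) → ℝ := fun x => ∏ j ∈ Finset.range n, if x j then 1 - r j else r j
  have hP : ∀ x, 0 < P x := aux_Ppos p hp n
  have hQ : ∀ x, 0 < Q x := aux_Ppos r hr01 n
  have hμP : ∀ x, (μ (cyl x n)).toReal = P x := by
    intro x
    rw [hμ n x, ENNReal.toReal_ofReal (hP x).le]
  have hS : ∀ x ∈ S, 1 ≤ P x ^ t * (2:ℝ) ^ ((n:ℝ) * c) := by
    intro x hx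
    have hx' : t * alphaN μ x n ≤ c := hx
    rw [alphaN, hμP, mul_div_assoc', div_le_iff₀ (by have := Real.log_pos one_lt_two; positivity)]
      at hx'
    rw [Real.rpow_def_of_pos (hP x), Real.rpow_def_of_pos (by norm_num : (0:ℝ) < 2),
      ← Real.exp_add]
    apply Real.one_le_exp
    nlinarith
  have hcov : S ⊆ ⋃ e ∈ (Finset.univ.filter fun e : Fin n → Bool => ext e ∈ S), cyl (ext e) n := by
    intro x hx
    have hc : cyl (ext fun i => x i) n = cyl x n := by
      ext y
      simp only [cyl, ext, mem_setOf_eq]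
      refine forall_congr' fun i => forall_congr' fun hi => ?_
      simp [hi]
    simp only [mem_iUnion]
    refine ⟨fun i => x i, ?_, ?_⟩
    · simp only [Finset.mem_filter, Finset.mem_univ, true_and]
      show t * alphaN μ _ n ≤ c
      rw [alphaN, hc]; exact hx
    · rw [hc]; intro i _; rfl
  have hsum : ∑ e : Fin n → Bool, Q (ext e) * P (ext e) ^ t
      = (2:ℝ) ^ ((n:ℝ) * (tauN p n (q + t) - tauN p n q)) := by
    have h1 : ∀ e : Fin n → Bool, Q (ext e) * P (ext e) ^ t =
        ∏ j : Fin n, ((if e j then 1 - r j else r j) * (if e j then 1 - p j else p j) ^ t) := by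
      intro e
      simp only [Q, P]
      rw [← Real.finset_prod_rpow, ← Finset.prod_mul_distrib, Finset.prod_range]
      · refine Finset.prod_congr rfl fun j _ => ?_
        simp [ext]
      · intro j _
        have := hp j
        split_ifs
        · linarith [this.2]
        · exact this.1.le
    rw [Finset.sum_congr rfl fun e _ => h1 e]
    have h2 := Finset.prod_univ_sum (fun _ : Fin n => (Finset.univ : Finset Bool))
      (fun j b => (if b then 1 - r j else r j) * (if b then 1 - p j else p j) ^ t)
    rw [Fintype.piFinset_univ] at h2
    rw [← h2, mul_sub, Real.rpow_sub (by norm_num), ← aux_tau p hp _ n hn, ← aux_tau p hp _ n hn,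
      ← Finset.prod_div_distrib, Finset.prod_range]
    refine Finset.prod_congr rfl fun j _ => ?_
    have h1 := (hp j).1
    have h2 : 0 < 1 - p j := by linarith [(hp j).2]
    have h3 := aux_Zpos (hp j) q
    simp only [Fintype.univ_bool, Finset.mem_singleton, Bool.true_eq_false, not_false_eq_true,
      Finset.sum_insert, Finset.sum_singleton, if_true, hr, Bool.false_eq_true, if_false]
    rw [Real.rpow_add h1, Real.rpow_add h2]
    field_simp
    ring
  calc ν S ≤ ν (⋃ e ∈ (Finset.univ.filter fun e : Fin n → Bool => ext e ∈ S), cyl (ext e) n) :=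
        measure_mono hcov
    _ ≤ ∑ e ∈ (Finset.univ.filter fun e : Fin n → Bool => ext e ∈ S), ν (cyl (ext e) n) :=
        measure_biUnion_finset_le _ _
    _ = ∑ e ∈ (Finset.univ.filter fun e : Fin n → Bool => ext e ∈ S),
          ENNReal.ofReal (Q (ext e)) := Finset.sum_congr rfl fun e _ => hν n (ext e)
    _ = ENNReal.ofReal (∑ e ∈ (Finset.univ.filter fun e : Fin n → Bool => ext e ∈ S),
          Q (ext e)) := (ENNReal.ofReal_sum_of_nonneg fun e _ => (hQ _).le).symm
    _ ≤ _ := by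
      apply ENNReal.ofReal_le_ofReal
      calc ∑ e ∈ (Finset.univ.filter fun e : Fin n → Bool => ext e ∈ S), Q (ext e)
          ≤ ∑ e ∈ (Finset.univ.filter fun e : Fin n → Bool => ext e ∈ S),
            Q (ext e) * P (ext e) ^ t * (2:ℝ) ^ ((n:ℝ) * c) := by
            refine Finset.sum_le_sum fun e he => ?_
            rw [mul_assoc]
            exact le_mul_of_one_le_right (hQ _).le (hS _ (Finset.mem_filter.1 he).2)
        _ ≤ ∑ e : Fin n → Bool, Q (ext e) * P (ext e) ^ t * (2:ℝ) ^ ((n:ℝ) * c) := by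
            refine Finset.sum_le_sum_of_subset_of_nonneg (Finset.filter_subset _ _) ?_
            intro e _ _
            have := hP (ext e)
            have := hQ (ext e)
            positivity
        _ = _ := by
            rw [← Finset.sum_mul, hsum, ← Real.rpow_add (by norm_num)]
            congr 1; ring

lemma aux_freq (p : ℕ → ℝ) (hp : ∀ k, p k ∈ Set.Ioo (0:ℝ) 1)
    (μ : Measure (ℕ → Bool)) (hμ : IsBernoulli μ p)
    (q : ℝ) (ν : Measure (ℕ → Bool))
    (hν : IsBernoulli ν (fun k => p k ^ q / (p k ^ q + (1 - p k) ^ q)))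
    (t c : ℝ)
    (hq : BddAbove (Set.range fun n => tauN p n q) ∧ BddBelow (Set.range fun n => tauN p n q))
    (hqt : BddAbove (Set.range fun n => tauN p n (q + t)) ∧
      BddBelow (Set.range fun n => tauN p n (q + t)))
    (h : tauLq p (q + t) - tauLq p q < -c) :
    ∀ᵐ x ∂ν, ∃ᶠ n in atTop, c < t * alphaN μ x n := by
  obtain ⟨η, hη, hη'⟩ : ∃ η > 0, tauLq p (q + t) - tauLq p q + c = -(3 * η) :=
    ⟨-(tauLq p (q + t) - tauLq p q + c) / 3, by linarith, by ring⟩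
  have e1 : ∀ᶠ n in atTop, tauN p n (q + t) < tauLq p (q + t) + η := by
    apply eventually_lt_of_limsup_lt
    · show tauLq p (q + t) < _
      linarith
    · exact hqt.1.isBoundedUnder_of_range
  have e2 : ∃ᶠ n in atTop, tauLq p q - η < tauN p n q := by
    apply frequently_lt_of_lt_limsup
    · exact (hq.2.isBoundedUnder_of_range).isCoboundedUnder_le
    · show _ < tauLq p q
      linarith
  have e3 : ∃ᶠ n in atTop, 0 < n ∧
      ν {x | t * alphaN μ x n ≤ c} ≤ ENNReal.ofReal ((2:ℝ) ^ (-(η * n))) := by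
    refine (e2.and_eventually (e1.and (eventually_gt_atTop 0))).mono ?_
    rintro n ⟨h2, h1, hn⟩
    refine ⟨hn, (aux_cheb p hp μ hμ q ν hν t c n hn).trans ?_⟩
    apply ENNReal.ofReal_le_ofReal
    apply Real.rpow_le_rpow_of_exponent_le (by norm_num)
    have hn' : (0:ℝ) < n := by exact_mod_cast hn
    nlinarith
  have lim : Tendsto (fun n : ℕ => ENNReal.ofReal ((2:ℝ) ^ (-(η * n)))) atTop (𝓝 0) := by
    rw [← ENNReal.ofReal_zero]
    apply ENNReal.tendsto_ofReal
    have : ∀ n : ℕ, (2:ℝ) ^ (-(η * n)) = ((2:ℝ) ^ (-η)) ^ n := by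
      intro n
      rw [← Real.rpow_natCast, ← Real.rpow_mul (by norm_num)]
      congr 1; ring
    simp_rw [this]
    apply tendsto_pow_atTop_nhds_zero_of_lt_one (by positivity)
    exact Real.rpow_lt_one_of_one_lt_of_neg (by norm_num) (by linarith)
  have key : ∀ N : ℕ, ν {x | ∀ n ≥ N, t * alphaN μ x n ≤ c} = 0 := by
    intro N
    by_contra hne
    have hpos := pos_iff_ne_zero.2 hne
    have ev := (tendsto_order.1 lim).2 _ hpos
    obtain ⟨n, ⟨hn, hle⟩, hlt, hN⟩ := (e3.and_eventually (ev.and (eventually_ge_atTop N))).exists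
    have : ν {x | ∀ n ≥ N, t * alphaN μ x n ≤ c} ≤ ν {x | t * alphaN μ x n ≤ c} :=
      measure_mono fun x hx => hx n hN
    exact absurd (this.trans hle) (not_le.2 hlt)
  have key2 : ∀ᵐ x ∂ν, ∀ N : ℕ, ¬ ∀ n ≥ N, t * alphaN μ x n ≤ c := by
    rw [ae_all_iff]
    intro N
    rw [ae_iff]
    simpa using key N
  filter_upwards [key2] with x hx
  intro hcon
  simp only [not_lt] at hcon
  obtain ⟨N, hN⟩ := eventually_atTop.1 hcon
  exact hx N hN

lemma aux_bdd (p : ℕ → ℝ) (hp : ∀ k, p k ∈ Set.Ioo (0:ℝ) 1)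
    (μ : Measure (ℕ → Bool)) (hμ : IsBernoulli μ p)
    (q : ℝ) (ν : Measure (ℕ → Bool))
    (hν : IsBernoulli ν (fun k => p k ^ q / (p k ^ q + (1 - p k) ^ q)))
    (t : ℝ) (ht : 0 < t)
    (hq : BddBelow (Set.range fun n => tauN p n q))
    (hqt : BddAbove (Set.range fun n => tauN p n (q + -t))) :
    ∃ M : ℝ, ∀ᵐ x ∂ν, ∀ᶠ n in atTop, alphaN μ x n ≤ M := by
  obtain ⟨A, hA⟩ := hqt
  obtain ⟨B, hB⟩ := hq
  have hA' : ∀ n, tauN p n (q + -t) ≤ A := fun n => hA ⟨n, rfl⟩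
  have hB' : ∀ n, B ≤ tauN p n q := fun n => hB ⟨n, rfl⟩
  refine ⟨(A - B + 1) / t, ?_⟩
  have hle : ∀ n, ν {x | 0 < n ∧ -t * alphaN μ x n ≤ -(A - B + 1)} ≤
      ENNReal.ofReal ((1/2:ℝ) ^ n) := by
    intro n
    rcases Nat.eq_zero_or_pos n with h0 | hn
    · simp [h0]
    · refine (measure_mono (fun x hx => hx.2)).trans
        ((aux_cheb p hp μ hμ q ν hν (-t) (-(A - B + 1)) n hn).trans ?_)
      apply ENNReal.ofReal_le_ofReal
      have : (1/2:ℝ) ^ n = (2:ℝ) ^ (-(n:ℝ)) := by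
        rw [Real.rpow_neg (by norm_num), Real.rpow_natCast]; simp
      rw [this]
      apply Real.rpow_le_rpow_of_exponent_le (by norm_num)
      have hn' : (0:ℝ) < n := by exact_mod_cast hn
      nlinarith [hA' n, hB' n]
  have hs : ∑' n, ν {x | 0 < n ∧ -t * alphaN μ x n ≤ -(A - B + 1)} ≠ ∞ := by
    refine ne_top_of_le_ne_top ?_ (ENNReal.tsum_le_tsum hle)
    rw [← ENNReal.ofReal_tsum_of_nonneg (fun n => by positivity)
      (summable_geometric_of_lt_one (by norm_num) (by norm_num))]
    exact ENNReal.ofReal_ne_top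
  have h := ae_eventually_notMem hs
  filter_upwards [h] with x hx
  filter_upwards [hx, eventually_gt_atTop 0] with n hn h0
  by_contra hcon
  apply hn
  refine ⟨h0, ?_⟩
  rw [not_le, div_lt_iff₀ ht] at hcon
  linarith

lemma aux_slope (f : ℝ → ℝ) (d q : ℝ) (σ : ℝ) (hσ : σ ≠ 0) (s : Set ℝ)
    (hs : ∀ u > 0, q + u * σ ∈ s)
    (hf : HasDerivWithinAt f d s q) (ε δ : ℝ) (hε : 0 < ε) (hδ : 0 < δ) :
    ∃ u > 0, |u * σ| < δ ∧ f (q + u * σ) - f q < u * (σ * d + ε) := by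
  rw [hasDerivWithinAt_iff_isLittleO] at hf
  have hσ' : 0 < |σ| := abs_pos.2 hσ
  have h := hf.def (show 0 < ε / (2 * |σ|) by positivity)
  have lim : Tendsto (fun u : ℝ => q + u * σ) (𝓝[>] 0) (𝓝[s] q) := by
    rw [tendsto_nhdsWithin_iff]
    constructor
    · have : Tendsto (fun u : ℝ => q + u * σ) (𝓝 0) (𝓝 (q + 0 * σ)) :=
        Continuous.tendsto (by fun_prop) 0
      rw [zero_mul, add_zero] at this
      exact this.mono_left nhdsWithin_le_nhds
    · filter_upwards [self_mem_nhdsWithin] with u hu using hs u hu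
  have h1 := lim.eventually h
  have h2 : ∀ᶠ u : ℝ in 𝓝[>] 0, |u * σ| < δ := by
    have : Tendsto (fun u : ℝ => |u * σ|) (𝓝 0) (𝓝 (|0 * σ|)) :=
      Continuous.tendsto (by fun_prop) 0
    rw [zero_mul, abs_zero] at this
    exact (this.mono_left nhdsWithin_le_nhds).eventually_lt_const hδ
  obtain ⟨u, h1, h2, h3⟩ := (h1.and (h2.and self_mem_nhdsWithin)).exists
  have h3 : 0 < u := h3
  refine ⟨u, h3, h2, ?_⟩
  simp only [add_sub_cancel_left, Real.norm_eq_abs, smul_eq_mul, abs_mul, abs_of_pos h3] at h1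
  have h4 : ε / (2 * |σ|) * (u * |σ|) = u * ε / 2 := by field_simp
  rw [h4] at h1
  have := le_of_abs_le h1
  nlinarith

/-- **Lemma 2.4.** The Gibbs measure `ν` (the inhomogeneous Bernoulli product with
weights `p̃_k = p_k^q/(p_k^q + (1-p_k)^q)`) gives full mass to
`E̲_{-τ'(q⁻)} ∩ F̄_{-τ'(q⁺)}`. -/
theorem stmt9 (p : ℕ → ℝ) (hp : ∀ k, p k ∈ Set.Ioo (0:ℝ) 1)
    (μ : Measure (ℕ → Bool)) [IsProbabilityMeasure μ] (hμ : IsBernoulli μ p)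
    (q : ℝ) (hfin : TauFiniteNear p q)
    (τl τr : ℝ)
    (hl : HasDerivWithinAt (tauLq p) τl (Set.Iic q) q)
    (hr : HasDerivWithinAt (tauLq p) τr (Set.Ici q) q)
    (ν : Measure (ℕ → Bool)) [IsProbabilityMeasure ν]
    (hν : IsBernoulli ν (fun k => p k ^ q / (p k ^ q + (1 - p k) ^ q))) :
    ν ({x | alphaDim μ x ≤ -τl} ∩
        {x | -τr ≤ Filter.limsup (fun n => alphaN μ x n) Filter.atTop}) = 1 := by
  obtain ⟨δ, hδ, hB⟩ := hfin
  have hB' : ∀ t, |t| < δ → BddAbove (Set.range fun n => tauN p n (q + t)) ∧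
      BddBelow (Set.range fun n => tauN p n (q + t)) := by
    intro t ht
    rw [abs_lt] at ht
    exact hB _ ⟨by linarith, by linarith⟩
  have hq := hB' 0 (by simpa using hδ)
  rw [add_zero] at hq
  have hpos : ∀ x n, 0 ≤ alphaN μ x n := by
    intro x n
    unfold alphaN
    have h1 : Real.log (μ (cyl x n)).toReal ≤ 0 :=
      Real.log_nonpos ENNReal.toReal_nonneg (ENNReal.toReal_le_of_le_ofReal zero_le_one
        (by simpa using prob_le_one))
    have h2 := Real.log_pos one_lt_two
    apply div_nonneg (by linarith) (by positivity)
  obtain ⟨M, hM⟩ := aux_bdd p hp μ hμ q ν hν (δ / 2) (by linarith) hq.2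
    (hB' _ (by rw [abs_neg, abs_of_pos] <;> linarith)).1
  have hL : ∀ m : ℕ, ∀ᵐ x ∂ν, ∃ᶠ n in atTop, alphaN μ x n < -τl + 1 / ((m:ℝ) + 1) := by
    intro m
    obtain ⟨u, hu, hu1, hu2⟩ := aux_slope (tauLq p) τl q (-1) (by norm_num) (Set.Iic q)
      (fun u hu => by simp; linarith) hl (1 / ((m:ℝ) + 1)) δ (by positivity) hδ
    have := aux_freq p hp μ hμ q ν hν (u * (-1)) (-(u * (-1 * τl + 1 / ((m:ℝ) + 1)))) hq
      (hB' _ hu1) (by linarith)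
    filter_upwards [this] with x hx
    refine hx.mono fun n hn => ?_
    have : u * alphaN μ x n < u * (-1 * τl + 1 / ((m:ℝ) + 1)) := by linarith
    have := lt_of_mul_lt_mul_left this hu.le
    linarith
  have hR : ∀ m : ℕ, ∀ᵐ x ∂ν, ∃ᶠ n in atTop, -τr - 1 / ((m:ℝ) + 1) < alphaN μ x n := by
    intro m
    obtain ⟨u, hu, hu1, hu2⟩ := aux_slope (tauLq p) τr q 1 (by norm_num) (Set.Ici q)
      (fun u hu => by simp; linarith) hr (1 / ((m:ℝ) + 1)) δ (by positivity) hδ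
    have := aux_freq p hp μ hμ q ν hν (u * 1) (-(u * (1 * τr + 1 / ((m:ℝ) + 1)))) hq
      (hB' _ hu1) (by linarith)
    filter_upwards [this] with x hx
    refine hx.mono fun n hn => ?_
    have : u * (-(1 * τr + 1 / ((m:ℝ) + 1))) < u * alphaN μ x n := by linarith
    have := lt_of_mul_lt_mul_left this hu.le
    linarith
  have hlim := tendsto_one_div_add_atTop_nhds_zero_nat (𝕜 := ℝ)
  have hae : ∀ᵐ x ∂ν, x ∈ ({x | alphaDim μ x ≤ -τl} ∩
        {x | -τr ≤ Filter.limsup (fun n => alphaN μ x n) Filter.atTop}) := by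
    filter_upwards [ae_all_iff.2 hL, ae_all_iff.2 hR, hM] with x h1 h2 h3
    constructor
    · show alphaDim μ x ≤ -τl
      have h4 : Tendsto (fun m : ℕ => -τl + 1 / ((m:ℝ) + 1)) atTop (𝓝 (-τl + 0)) :=
        hlim.const_add _
      rw [add_zero] at h4
      refine ge_of_tendsto' h4 fun m => ?_
      exact liminf_le_of_frequently_le ((h1 m).mono fun n hn => hn.le)
        (isBoundedUnder_of ⟨0, hpos x⟩)
    · show -τr ≤ limsup (fun n => alphaN μ x n) atTop
      have h4 : Tendsto (fun m : ℕ => -τr - 1 / ((m:ℝ) + 1)) atTop (𝓝 (-τr - 0)) :=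
        hlim.const_sub _
      rw [sub_zero] at h4
      refine le_of_tendsto' h4 fun m => ?_
      exact le_limsup_of_frequently_le ((h2 m).mono fun n hn => hn.le) ⟨M, h3⟩
  exact (measure_eq_measure_of_null_sdiff (subset_univ _)
    (by rw [← compl_eq_univ_diff]; exact mem_ae_iff.1 hae)).trans measure_univ
end

section
/- Let 0 < p < p̃ < 1/2 and let (p_i)_{i≥1} be a sequence taking values in {p, p̃}. Set N_n = #{ i ≤ n : p_i = p }. If liminf_{n→∞} N_n/n = 0 and limsup_{n→∞} N_n/n = 1, then for every q ∈ ℝ the L^q-spectrum of the associated inhomogeneous Bernoulli product satisfies τ(q) = max( log₂(p^q + (1−p)^q), log₂(p̃^q + (1−p̃)^q) ). -/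
open MeasureTheory Filter Set
open scoped Topology ENNReal NNReal Classical

/-- If the weights take the two values `p < p̃ < 1/2` with `liminf N_n/n = 0` and
`limsup N_n/n = 1` (`N_n` the number of indices `i ≤ n` with `p_i = p`), then
`τ(q) = max(log₂(p^q + (1-p)^q), log₂(p̃^q + (1-p̃)^q))` for every `q`. -/
theorem stmt11 (pa pb : ℝ) (hpa : 0 < pa) (hab : pa < pb) (hpb : pb < 1 / 2)
    (ps : ℕ → ℝ) (hps : ∀ i, ps i = pa ∨ ps i = pb)
    (hinf : Filter.liminf
        (fun n : ℕ => (((Finset.range n).filter fun i => ps i = pa).card : ℝ) / n)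
        Filter.atTop = 0)
    (hsup : Filter.limsup
        (fun n : ℕ => (((Finset.range n).filter fun i => ps i = pa).card : ℝ) / n)
        Filter.atTop = 1) :
    ∀ q : ℝ, tauLq ps q = max (tauP pa q) (tauP pb q) := by
  intro q
  set r : ℕ → ℝ := fun n : ℕ => (((Finset.range n).filter fun i => ps i = pa).card : ℝ) / n with hr
  set A := tauP pa q with hA
  set B := tauP pb q with hB
  have hr0 : ∀ n, 0 ≤ r n := fun n => by simp only [hr]; positivity
  have hr1 : ∀ n, r n ≤ 1 := fun n => by
    simp only [hr]
    apply div_le_one_of_le₀ _ (Nat.cast_nonneg n)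
    have h := Finset.card_filter_le (Finset.range n) (fun i => ps i = pa)
    rw [Finset.card_range] at h
    exact_mod_cast h
  have hab0 : IsBoundedUnder (· ≤ ·) atTop r := isBoundedUnder_of ⟨1, hr1⟩
  have hbb0 : IsBoundedUnder (· ≥ ·) atTop r := isBoundedUnder_of ⟨0, hr0⟩
  let f : ℝ → ℝ := fun x => B + (A - B) * x
  have hf : Continuous f := by fun_prop
  have key : (fun n => tauN ps n q) =ᶠ[atTop] f ∘ r := by
    filter_upwards [eventually_gt_atTop 0] with n hn
    have hn' : (n : ℝ) ≠ 0 := by positivity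
    have hs : ∑ k ∈ Finset.range n, tauP (ps k) q
        = ∑ k ∈ Finset.range n, (B + (A - B) * (if ps k = pa then 1 else 0)) := by
      apply Finset.sum_congr rfl
      intro k _
      rcases hps k with h | h
      · simp [h, hA]
      · rw [h, if_neg hab.ne']; simp [hB]
    simp only [tauN, Function.comp, f, hr]
    rw [hs, Finset.sum_add_distrib, ← Finset.mul_sum, Finset.sum_boole]
    simp only [Finset.sum_const, Finset.card_range, nsmul_eq_mul]
    field_simp
  unfold tauLq
  rw [limsup_congr key]
  rcases le_total B A with h | h
  · have hm : Monotone f := fun x y hxy => by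
      have := mul_le_mul_of_nonneg_left hxy (sub_nonneg.2 h)
      simp only [f]; linarith
    rw [← hm.map_limsup_of_continuousAt r hf.continuousAt hab0 hbb0.isCoboundedUnder_le, hsup,
      max_eq_left h]
    simp [f]
  · have hm : Antitone f := fun x y hxy => by
      have := mul_le_mul_of_nonneg_left hxy (sub_nonneg.2 h)
      simp only [f]; linarith
    rw [← hm.map_liminf_of_continuousAt r hf.continuousAt hab0.isCoboundedUnder_ge hbb0, hinf,
      max_eq_right h]
    simp [f]
end

section
/- Let 0 < p < p̃ < 1/2 and let (p_i)_{i≥1} be a sequence taking values in {p, p̃}, and set N_n = #{ i ≤ n : p_i = p }. Assume liminf_{n→∞} N_n/n = 0. Then for the associated inhomogeneous Bernoulli product μ, every x ∈ Σ satisfies α(x) = liminf_n (−log₂ μ(I_n(x))/n) ≤ −log₂ p̃. Consequently, the level set E_α = {x : α(x) = α} is empty for every α > −log₂ p̃. -/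
open MeasureTheory Filter Set
open scoped Topology ENNReal NNReal Classical

/-- If the weights take the two values `p < p̃ < 1/2` and `liminf N_n/n = 0`, then
every `x ∈ Σ` satisfies `α(x) ≤ -log₂ p̃`; consequently `E_α = ∅` for every
`α > -log₂ p̃`. -/
theorem stmt12 (pa pb : ℝ) (hpa : 0 < pa) (hab : pa < pb) (hpb : pb < 1 / 2)
    (ps : ℕ → ℝ) (hps : ∀ i, ps i = pa ∨ ps i = pb)
    (hinf : Filter.liminf
        (fun n : ℕ => (((Finset.range n).filter fun i => ps i = pa).card : ℝ) / n)
        Filter.atTop = 0)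
    (μ : Measure (ℕ → Bool)) [IsProbabilityMeasure μ] (hμ : IsBernoulli μ ps) :
    (∀ x : ℕ → Bool, alphaDim μ x ≤ -Real.logb 2 pb) ∧
    (∀ α : ℝ, -Real.logb 2 pb < α → {x : ℕ → Bool | alphaDim μ x = α} = ∅) := by
  have key : ∀ x : ℕ → Bool, alphaDim μ x ≤ -Real.logb 2 pb := by
    intro x
    have hl2 : 0 < Real.log 2 := Real.log_pos (by norm_num)
    have hpb0 : 0 < pb := hpa.trans hab
    have hlog : Real.log pa < Real.log pb := Real.log_lt_log hpa hab
    have hpos : ∀ j, 0 < (if x j then 1 - ps j else ps j) := by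
      intro j
      rcases hps j with h | h <;> rw [h] <;> split_ifs <;> linarith
    have hmu : ∀ n, Real.log (μ (cyl x n)).toReal
        = ∑ j ∈ Finset.range n, Real.log (if x j then 1 - ps j else ps j) := by
      intro n
      rw [hμ n x, ENNReal.toReal_ofReal (Finset.prod_nonneg fun j _ => (hpos j).le),
        Real.log_prod (fun j _ => (hpos j).ne')]
    have hterm : ∀ j, Real.log pb - (if ps j = pa then (Real.log pb - Real.log pa) else 0)
        ≤ Real.log (if x j then 1 - ps j else ps j) := by
      intro j
      have h1 : Real.log (ps j) ≤ Real.log (if x j then 1 - ps j else ps j) := by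
        apply Real.log_le_log
        · rcases hps j with h | h <;> rw [h] <;> assumption
        · rcases hps j with h | h <;> rw [h] <;> split_ifs <;> linarith
      refine le_trans ?_ h1
      rcases hps j with h | h
      · simp [h]
      · simp [h, hab.ne']
    have hbound : ∀ n : ℕ, 0 < n → alphaN μ x n ≤ -Real.logb 2 pb +
        ((((Finset.range n).filter fun i => ps i = pa).card : ℝ) / n)
          * ((Real.log pb - Real.log pa) / Real.log 2) := by
      intro n hn
      have hn' : (0:ℝ) < n := by exact_mod_cast hn
      have hs := Finset.sum_le_sum (s := Finset.range n) (fun j _ => hterm j)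
      rw [← hmu n, Finset.sum_sub_distrib, ← Finset.sum_filter, Finset.sum_const,
        Finset.sum_const, Finset.card_range, nsmul_eq_mul, nsmul_eq_mul] at hs
      unfold alphaN Real.logb
      rw [div_le_iff₀ (by positivity)]
      field_simp
      linarith
    have hnn : ∀ n, 0 ≤ alphaN μ x n := by
      intro n
      unfold alphaN
      apply div_nonneg
      · have : (μ (cyl x n)).toReal ≤ 1 := by
          have := ENNReal.toReal_mono ENNReal.one_ne_top (prob_le_one (μ := μ) (s := cyl x n))
          simpa using this
        have := Real.log_nonpos ENNReal.toReal_nonneg this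
        linarith
      · positivity
    refine le_of_forall_pos_le_add fun ε hε => ?_
    have hC : 0 < (Real.log pb - Real.log pa) / Real.log 2 := div_pos (by linarith) hl2
    have hfreq := Filter.frequently_lt_of_liminf_lt (b := ε / ((Real.log pb - Real.log pa) / Real.log 2))
      (u := fun n : ℕ => (((Finset.range n).filter fun i => ps i = pa).card : ℝ) / n)
      (f := Filter.atTop) (by
        apply Filter.IsBoundedUnder.isCoboundedUnder_ge
        refine Filter.isBoundedUnder_of ⟨1, fun n => ?_⟩
        apply div_le_one_of_le₀ _ (Nat.cast_nonneg n)
        have := Finset.card_filter_le (Finset.range n) (fun i => ps i = pa)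
        rw [Finset.card_range] at this
        exact_mod_cast this) (by rw [hinf]; positivity)
    refine Filter.liminf_le_of_frequently_le ?_ (Filter.isBoundedUnder_of ⟨0, hnn⟩)
    refine (hfreq.and_eventually (Filter.eventually_gt_atTop 0)).mono ?_
    rintro n ⟨h1, h2⟩
    rw [lt_div_iff₀ hC] at h1
    have := hbound n h2
    linarith
  refine ⟨key, fun α hα => ?_⟩
  ext x
  simp only [Set.mem_ofPred_eq, Set.mem_empty_iff_false, iff_false]
  intro h
  have := key x
  linarith
end

section
/- Let 0 < p₁ < p₂ < p₃ < 1/2 and write τ_i(q) = log₂(p_i^q + (1−p_i)^q) for i = 1,2,3. Then for q > 1 one has τ₁(q) > τ₂(q) > τ₃(q), and the function q ↦ (τ₁(q) − τ₂(q)) / (τ₂(q) − τ₃(q)) is strictly decreasing on (1, +∞). -/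
open MeasureTheory Filter Set
open scoped Topology ENNReal NNReal Classical

lemma aux_tanh {s : ℝ} (hs : 0 < s) : Real.exp s ^ 2 - 1 < s * (Real.exp s ^ 2 + 1) := by
  have hm : StrictMonoOn (fun s : ℝ => s * Real.cosh s - Real.sinh s) (Set.Ici 0) := by
    apply strictMonoOn_of_deriv_pos (convex_Ici 0)
    · fun_prop
    · intro x hx
      rw [interior_Ici] at hx
      have hd : HasDerivAt (fun s : ℝ => s * Real.cosh s - Real.sinh s)
          (1 * Real.cosh x + x * Real.sinh x - Real.cosh x) x :=
        ((hasDerivAt_id x).mul (Real.hasDerivAt_cosh x)).sub (Real.hasDerivAt_sinh x)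
      rw [hd.deriv]
      have := mul_pos hx (Real.sinh_pos_iff.2 hx)
      linarith
  have h := hm (Set.mem_Ici.2 le_rfl) (Set.mem_Ici.2 hs.le) hs
  simp only [Real.cosh_eq, Real.sinh_eq, Real.exp_neg] at h
  norm_num at h
  have hE := Real.exp_pos s
  have h2 := mul_lt_mul_of_pos_right h hE
  have h3 : Real.exp s * (Real.exp s)⁻¹ = 1 := mul_inv_cancel₀ hE.ne'
  nlinarith

lemma aux_ineq {s w : ℝ} (hs : 0 < s) (hw : s < w) :
    (Real.exp s - 1 - s * Real.exp s) / (Real.exp s - 1) ^ 2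
      + (Real.exp w + 1 - w * Real.exp w) / (Real.exp w + 1) ^ 2 < 0 := by
  have hE1 : 1 < Real.exp s := Real.one_lt_exp_iff.2 hs
  have hEF : Real.exp s < Real.exp w := Real.exp_lt_exp.2 hw
  have ht := aux_tanh hs
  have hB : Real.exp s - 1 - s * Real.exp s < 0 := by
    have h := Real.add_one_lt_exp (neg_ne_zero.2 hs.ne')
    rw [Real.exp_neg] at h
    have hE := Real.exp_pos s
    have h2 := mul_lt_mul_of_pos_right h hE
    rw [inv_mul_cancel₀ hE.ne'] at h2
    nlinarith
  set E := Real.exp s with hEd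
  set F := Real.exp w with hFd
  have hE1' : 0 < E - 1 := by linarith
  have hB' : (E - 1 - s * E) / (E - 1) ^ 2 < 0 := div_neg_of_neg_of_pos hB (by positivity)
  by_cases hc : F + 1 - w * F ≤ 0
  · have : (F + 1 - w * F) / (F + 1) ^ 2 ≤ 0 := div_nonpos_of_nonpos_of_nonneg hc (by positivity)
    linarith
  · push Not at hc
    have h1 : (F + 1 - w * F) / (F + 1) ^ 2 ≤ (E + 1 - s * E) / (E + 1) ^ 2 := by
      have e1 : (F + 1 - w * F) / (F + 1) ^ 2 = ((F + 1 - w * F) / (F + 1)) * (1 / (F + 1)) := by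
        field_simp
      have e2 : (E + 1 - s * E) / (E + 1) ^ 2 = ((E + 1 - s * E) / (E + 1)) * (1 / (E + 1)) := by
        field_simp
      rw [e1, e2]
      have h3 : (F + 1 - w * F) / (F + 1) ≤ (E + 1 - s * E) / (E + 1) := by
        rw [div_le_div_iff₀ (by positivity) (by positivity)]
        nlinarith [mul_pos (sub_pos.2 hw) (by positivity : 0 < F * E), mul_pos hs (sub_pos.2 hEF),
          mul_pos (sub_pos.2 hw) (by linarith : 0 < F)]
      have h4 : 1 / (F + 1) ≤ 1 / (E + 1) := one_div_le_one_div_of_le (by positivity) (by linarith)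
      have h5 : 0 < (F + 1 - w * F) / (F + 1) := div_pos hc (by positivity)
      exact mul_le_mul h3 h4 (by positivity) (h5.le.trans h3)
    have h2 : (E - 1 - s * E) / (E - 1) ^ 2 + (E + 1 - s * E) / (E + 1) ^ 2 < 0 := by
      rw [div_add_div _ _ (by positivity) (by positivity)]
      apply div_neg_of_neg_of_pos _ (by positivity)
      have : (E - 1 - s * E) * (E + 1) ^ 2 + (E - 1) ^ 2 * (E + 1 - s * E)
        = 2 * E * ((E ^ 2 - 1) - s * (E ^ 2 + 1)) := by ring
      rw [this]
      exact mul_neg_of_pos_of_neg (by positivity) (by linarith)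
    linarith

lemma aux_K {t : ℝ} (ht : 0 < t) :
    StrictAntiOn (fun s : ℝ => s / (Real.exp s - 1) + (s + t) / (Real.exp (s + t) + 1))
      (Set.Ioi 0) := by
  have hd : ∀ x ∈ Set.Ioi (0:ℝ), HasDerivAt
      (fun s : ℝ => s / (Real.exp s - 1) + (s + t) / (Real.exp (s + t) + 1))
      ((Real.exp x - 1 - x * Real.exp x) / (Real.exp x - 1) ^ 2
      + (Real.exp (x + t) + 1 - (x + t) * Real.exp (x + t)) / (Real.exp (x + t) + 1) ^ 2) x := by
    intro x hx
    have hE1 : 1 < Real.exp x := Real.one_lt_exp_iff.2 hx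
    have a := (hasDerivAt_id x).div ((Real.hasDerivAt_exp x).sub_const 1) (by simp; linarith)
    have i := (hasDerivAt_id x).add_const t
    have b := i.div (i.exp.add_const 1) (by simp; positivity)
    refine HasDerivAt.congr_deriv (HasDerivAt.congr_of_eventuallyEq (a.add b) (Filter.Eventually.of_forall fun _ => rfl)) ?_
    simp
  apply strictAntiOn_of_deriv_neg (convex_Ioi 0)
  · intro x hx
    exact (hd x hx).continuousAt.continuousWithinAt
  · intro x hx
    rw [interior_Ioi] at hx
    rw [(hd x hx).deriv]
    exact aux_ineq hx (by linarith)

noncomputable def phi (q t : ℝ) : ℝ :=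
  Real.log (1 - Real.exp (-((q - 1) * t))) - Real.log (1 + Real.exp (-(q * t)))

lemma phi_deriv {q t : ℝ} (hq : 1 < q) (ht : 0 < t) :
    HasDerivAt (phi q) ((((q - 1) * t) / (Real.exp ((q - 1) * t) - 1)
      + ((q - 1) * t + t) / (Real.exp ((q - 1) * t + t) + 1)) / t) t := by
  have hs : 0 < (q - 1) * t := mul_pos (by linarith) ht
  have hE1 : 1 < Real.exp ((q - 1) * t) := Real.one_lt_exp_iff.2 hs
  have hlt : Real.exp (-((q - 1) * t)) < 1 := Real.exp_lt_one_iff.2 (by linarith)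
  have a := ((((hasDerivAt_id t).const_mul (q - 1)).neg.exp).const_sub 1).log
    (by simp; linarith)
  have b := ((((hasDerivAt_id t).const_mul q).neg.exp).const_add 1).log
    (by simp; positivity)
  have c := a.sub b
  have e : (q - 1) * t + t = q * t := by ring
  rw [e]
  refine HasDerivAt.congr_deriv (HasDerivAt.congr_of_eventuallyEq c (Filter.Eventually.of_forall fun _ => rfl)) ?_
  simp only [id, Pi.neg_apply, mul_one, Real.exp_neg] at hlt ⊢
  have hF := Real.exp_pos (q * t)
  set E := Real.exp ((q - 1) * t)
  set F := Real.exp (q * t)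
  have : E - 1 ≠ 0 := by linarith
  have : 1 - E⁻¹ ≠ 0 := by linarith
  have h1 : 1 - E⁻¹ = (E - 1) / E := by field_simp
  have h2 : 1 + F⁻¹ = (F + 1) / F := by field_simp
  rw [h1, h2]
  field_simp
  ring

lemma phi_anti {q q' : ℝ} (hq : 1 < q) (hqq : q < q') :
    StrictAntiOn (fun t => phi q' t - phi q t) (Set.Ioi 0) := by
  have hd : ∀ x ∈ Set.Ioi (0:ℝ), _ := fun x hx =>
    (phi_deriv (hq.trans hqq) hx).sub (phi_deriv hq hx)
  apply strictAntiOn_of_deriv_neg (convex_Ioi 0)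
  · intro x hx
    exact (hd x hx).continuousAt.continuousWithinAt
  · intro x hx
    rw [interior_Ioi] at hx
    have hx' : 0 < x := hx
    have e : deriv (fun t => phi q' t - phi q t) x = _ := (hd x hx).deriv
    rw [e, ← sub_div]
    apply div_neg_of_neg_of_pos _ hx
    have := aux_K hx' (a := (q - 1) * x) (b := (q' - 1) * x)
      (mul_pos (by linarith) hx') (mul_pos (by linarith) hx')
      (mul_lt_mul_of_pos_right (by linarith) hx')
    simp only at this
    linarith

noncomputable def gP (q p : ℝ) : ℝ :=
  (q * (1 - p) ^ (q - 1) - q * p ^ (q - 1)) / (p ^ q + (1 - p) ^ q)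

noncomputable def fP (q p : ℝ) : ℝ := - Real.log (p ^ q + (1 - p) ^ q)

lemma fP_deriv {q p : ℝ} (h0 : 0 < p) (h1 : p < 1 / 2) : HasDerivAt (fP q) (gP q p) p := by
  have hp : 0 < 1 - p := by linarith
  have a := (hasDerivAt_id p).rpow_const (p := q) (Or.inl h0.ne')
  have b := ((hasDerivAt_id p).const_sub 1).rpow_const (p := q) (Or.inl hp.ne')
  have hpos : 0 < p ^ q + (1 - p) ^ q := by positivity
  have c := ((a.add b).log hpos.ne').neg
  refine HasDerivAt.congr_deriv (HasDerivAt.congr_of_eventuallyEq c (Filter.Eventually.of_forall fun _ => rfl)) ?_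
  simp only [gP, id, Pi.add_apply]
  rw [← neg_div]
  congr 1
  ring

lemma gP_eq {q p : ℝ} (hq : 1 < q) (h0 : 0 < p) (h1 : p < 1 / 2) :
    gP q p = q / (1 - p) * Real.exp (phi q (Real.log ((1 - p) / p))) := by
  have hp : 0 < 1 - p := by linarith
  have ht : 0 < Real.log ((1 - p) / p) := Real.log_pos (by rw [lt_div_iff₀ h0]; linarith)
  have hs : 0 < (q - 1) * Real.log ((1 - p) / p) := mul_pos (by linarith) ht
  have hlt : Real.exp (-((q - 1) * Real.log ((1 - p) / p))) < 1 := Real.exp_lt_one_iff.2 (by linarith)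
  have key : ∀ a : ℝ, Real.exp (-(a * Real.log ((1 - p) / p))) = p ^ a / (1 - p) ^ a := by
    intro a
    rw [← Real.div_rpow h0.le hp.le, Real.rpow_def_of_pos (by positivity),
      Real.log_div hp.ne' h0.ne', Real.log_div h0.ne' hp.ne']
    congr 1
    ring
  rw [phi, Real.exp_sub, Real.exp_log (by linarith), Real.exp_log (by positivity), key, key, gP]
  have e : (1 - p) ^ q = (1 - p) ^ (q - 1) * (1 - p) := by
    rw [Real.rpow_sub_one hp.ne']; field_simp
  have : 0 < (1 - p) ^ (q - 1) := by positivity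
  have : 0 < p ^ q := by positivity
  rw [e]
  have : 0 < p ^ q + (1 - p) ^ (q - 1) * (1 - p) := by positivity
  have : 0 < (1 - p) ^ (q - 1) * (1 - p) + p ^ q  := by positivity
  field_simp
  ring

lemma gP_pos {q p : ℝ} (hq : 1 < q) (h0 : 0 < p) (h1 : p < 1 / 2) : 0 < gP q p := by
  rw [gP_eq hq h0 h1]
  have hp : 0 < 1 - p := by linarith
  positivity

lemma gP_ratio {q q' x y : ℝ} (hq : 1 < q) (hqq : q < q') (h0 : 0 < x) (hxy : x < y)
    (h1 : y < 1 / 2) : gP q' x / gP q x < gP q' y / gP q y := by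
  have hq' := hq.trans hqq
  have key : ∀ p, 0 < p → p < 1 / 2 → gP q' p / gP q p = q' / q *
      Real.exp (phi q' (Real.log ((1 - p) / p)) - phi q (Real.log ((1 - p) / p))) := by
    intro p h0 h1
    have hp : 0 < 1 - p := by linarith
    rw [gP_eq hq h0 h1, gP_eq hq' h0 h1, Real.exp_sub]
    field_simp
  have hy := h0.trans hxy
  rw [key x h0 (hxy.trans h1), key y hy h1]
  apply mul_lt_mul_of_pos_left _ (by positivity)
  apply Real.exp_lt_exp.2
  have ht : ∀ p, 0 < p → p < 1 / 2 → 0 < Real.log ((1 - p) / p) := fun p h0 h1 =>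
    Real.log_pos (by rw [lt_div_iff₀ h0]; linarith)
  apply phi_anti hq hqq (ht y hy h1) (ht x h0 (hxy.trans h1))
  apply Real.log_lt_log (div_pos (by linarith) hy)
  rw [div_lt_div_iff₀ hy h0]
  nlinarith

lemma fP_lt {q x y : ℝ} (hq : 1 < q) (h0 : 0 < x) (hxy : x < y) (h1 : y < 1 / 2) :
    fP q x < fP q y := by
  obtain ⟨c, hc, h⟩ := exists_hasDerivAt_eq_slope (fP q) (gP q) hxy
    (fun z hz => (fP_deriv (by linarith [hz.1]) (by linarith [hz.2])).continuousAt.continuousWithinAt)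
    (fun z hz => fP_deriv (by linarith [hz.1]) (by linarith [hz.2]))
  have := gP_pos hq (h0.trans hc.1) (hc.2.trans h1)
  rw [h, div_pos_iff_of_pos_right (by linarith)] at this
  linarith

lemma fP_cauchy {q q' x y : ℝ} (hq : 1 < q) (hqq : q < q') (h0 : 0 < x) (hxy : x < y)
    (h1 : y < 1 / 2) :
    ∃ c ∈ Set.Ioo x y, (fP q' y - fP q' x) / (fP q y - fP q x) = gP q' c / gP q c := by
  obtain ⟨c, hc, h⟩ := exists_ratio_hasDerivAt_eq_ratio_slope (fP q) (gP q) hxy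
    (fun z hz => (fP_deriv (by linarith [hz.1]) (by linarith [hz.2])).continuousAt.continuousWithinAt)
    (fun z hz => fP_deriv (by linarith [hz.1]) (by linarith [hz.2])) (fP q') (gP q')
    (fun z hz => (fP_deriv (by linarith [hz.1]) (by linarith [hz.2])).continuousAt.continuousWithinAt)
    (fun z hz => fP_deriv (by linarith [hz.1]) (by linarith [hz.2]))
  refine ⟨c, hc, ?_⟩
  have := gP_pos hq (h0.trans hc.1) (hc.2.trans h1)
  have := fP_lt hq h0 hxy h1
  rw [div_eq_div_iff (by linarith) (by linarith)]
  linarith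

theorem stmt13 (p₁ p₂ p₃ : ℝ) (h₁ : 0 < p₁) (h₁₂ : p₁ < p₂) (h₂₃ : p₂ < p₃)
    (h₃ : p₃ < 1 / 2) :
    (∀ q : ℝ, 1 < q → tauP p₂ q < tauP p₁ q ∧ tauP p₃ q < tauP p₂ q) ∧
    StrictAntiOn (fun q => (tauP p₁ q - tauP p₂ q) / (tauP p₂ q - tauP p₃ q))
      (Set.Ioi (1:ℝ)) := by
  have hl : 0 < Real.log 2 := Real.log_pos (by norm_num)
  have e : ∀ p q, tauP p q = - fP q p / Real.log 2 := by
    intro p q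
    simp [tauP, fP, Real.logb]
  have h2 : 0 < p₂ := h₁.trans h₁₂
  have h2' : p₂ < 1 / 2 := h₂₃.trans h₃
  constructor
  · intro q hq
    simp only [e]
    constructor
    · exact div_lt_div_of_pos_right (by linarith [fP_lt hq h₁ h₁₂ h2']) hl
    · exact div_lt_div_of_pos_right (by linarith [fP_lt hq h2 h₂₃ h₃]) hl
  · intro q hq q' hq' hqq
    have hq : 1 < q := hq
    have hq' : 1 < q' := hq'
    have e2 : ∀ q, (tauP p₁ q - tauP p₂ q) / (tauP p₂ q - tauP p₃ q)
        = (fP q p₂ - fP q p₁) / (fP q p₃ - fP q p₂) := by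
      intro q
      rw [e, e, e, ← sub_div, ← sub_div, div_div_div_cancel_right₀ hl.ne']
      congr 1 <;> ring
    simp only [e2]
    obtain ⟨c, hc, ec⟩ := fP_cauchy hq hqq h₁ h₁₂ h2'
    obtain ⟨d, hd, ed⟩ := fP_cauchy hq hqq h2 h₂₃ h₃
    have hr := gP_ratio hq hqq (h₁.trans hc.1) (hc.2.trans hd.1) (hd.2.trans h₃)
    rw [← ec, ← ed] at hr
    have a1 := fP_lt hq h₁ h₁₂ h2'
    have a2 := fP_lt hq h2 h₂₃ h₃
    have a3 := fP_lt hq' h2 h₂₃ h₃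
    rw [div_lt_div_iff₀ (by linarith) (by linarith)] at hr ⊢
    linarith
end
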